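/- arXiv:2601.03691 — 5 statements merged into one kernel-verified Lean document; each statement's English description precedes it below -/
import Mathlib

section
/- Let k be a field of characteristic p > 0 and let l ≥ 1 be an integer. Let R be the localization of the ring k[x,y,z]/(z^{l+1} - x·y) at the maximal ideal generated by the images of x, y, z (the rational double point of type A_l). Then: (a) the R-module Der_k(R) of k-linear derivations of R is free if and only if p divides l+1; and (b) there exist a k-linear derivation D of R and an element f ∈ R such that D(f) is a unit if and only if p divides l+1. -/
open MvPolynomial

noncomputable section

/-- Evaluation at the origin on `k[x,y,z]/(P)`, for `P` with zero constant term. -/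
def rdpEval (k : Type*) [Field k] (P : MvPolynomial (Fin 3) k)
    (hP : constantCoeff P = 0) :
    (MvPolynomial (Fin 3) k ⧸ Ideal.span {P}) →+* k :=
  Ideal.Quotient.lift (Ideal.span {P}) (constantCoeff : MvPolynomial (Fin 3) k →+* k)
    (by
      intro a ha
      rw [Ideal.mem_span_singleton] at ha
      obtain ⟨c, rfl⟩ := ha
      rw [map_mul, hP, zero_mul])

/-- The maximal ideal of `k[x,y,z]/(P)` generated by the images of `x, y, z`, realized
as the kernel of evaluation at the origin. -/
def rdpMaxIdeal (k : Type*) [Field k] (P : MvPolynomial (Fin 3) k)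
    (hP : constantCoeff P = 0) : Ideal (MvPolynomial (Fin 3) k ⧸ Ideal.span {P}) :=
  RingHom.ker (rdpEval k P hP)

instance rdpMaxIdeal_isPrime (k : Type*) [Field k] (P : MvPolynomial (Fin 3) k)
    (hP : constantCoeff P = 0) : (rdpMaxIdeal k P hP).IsPrime :=
  RingHom.ker_isPrime _

/-- The local ring of the singularity: the localization of `k[x,y,z]/(P)` at the maximal
ideal generated by the images of `x, y, z`. -/
def rdpLocal (k : Type*) [Field k] (P : MvPolynomial (Fin 3) k)
    (hP : constantCoeff P = 0) : Type _ :=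
  Localization (rdpMaxIdeal k P hP).primeCompl

instance rdpLocalCommRing (k : Type*) [Field k] (P : MvPolynomial (Fin 3) k)
    (hP : constantCoeff P = 0) : CommRing (rdpLocal k P hP) :=
  inferInstanceAs (CommRing (Localization _))

instance rdpLocalAlgebra (k : Type*) [Field k] (P : MvPolynomial (Fin 3) k)
    (hP : constantCoeff P = 0) : Algebra k (rdpLocal k P hP) :=
  inferInstanceAs (Algebra k (Localization _))


namespace RDPA
universe u
variable {k : Type u} [Field k] {P : MvPolynomial (Fin 3) k} {hP : constantCoeff P = 0}

/-- The structure map from the polynomial ring. -/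
def iot (k : Type u) [Field k] (P : MvPolynomial (Fin 3) k) (hP : constantCoeff P = 0) :
    MvPolynomial (Fin 3) k →ₐ[k] rdpLocal k P hP :=
  (IsScalarTower.toAlgHom k (MvPolynomial (Fin 3) k ⧸ Ideal.span {P})
    (Localization (rdpMaxIdeal k P hP).primeCompl)).comp (Ideal.Quotient.mkₐ k (Ideal.span {P}))

lemma mem_compl (f : MvPolynomial (Fin 3) k) :
    Ideal.Quotient.mk (Ideal.span {P}) f ∈ (rdpMaxIdeal k P hP).primeCompl ↔
      constantCoeff f ≠ 0 := by
  change ¬ (rdpEval k P hP (Ideal.Quotient.mk (Ideal.span {P}) f) = 0) ↔ _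
  simp [rdpEval]

lemma iot_apply (f : MvPolynomial (Fin 3) k) : iot k P hP f =
    algebraMap (MvPolynomial (Fin 3) k ⧸ Ideal.span {P})
      (Localization (rdpMaxIdeal k P hP).primeCompl) (Ideal.Quotient.mk _ f) := rfl

lemma iot_unit (f : MvPolynomial (Fin 3) k) (hf : constantCoeff f ≠ 0) :
    IsUnit (iot k P hP f) := by
  have := IsLocalization.map_units (M := (rdpMaxIdeal k P hP).primeCompl)
    (Localization (rdpMaxIdeal k P hP).primeCompl)
    ⟨Ideal.Quotient.mk (Ideal.span {P}) f, (mem_compl f).2 hf⟩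
  exact this

lemma iot_P : iot k P hP P = 0 := by
  rw [iot_apply, Ideal.Quotient.eq_zero_iff_mem.2 (Ideal.mem_span_singleton_self P)]
  exact map_zero (algebraMap (MvPolynomial (Fin 3) k ⧸ Ideal.span {P})
      (Localization (rdpMaxIdeal k P hP).primeCompl))

lemma iot_surj (r : rdpLocal k P hP) : ∃ f s : MvPolynomial (Fin 3) k, constantCoeff s ≠ 0 ∧
    r * iot k P hP s = iot k P hP f := by
  obtain ⟨⟨f, s, hs⟩, h⟩ := IsLocalization.surj (rdpMaxIdeal k P hP).primeCompl
    (S := Localization (rdpMaxIdeal k P hP).primeCompl) r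
  obtain ⟨f, rfl⟩ := Ideal.Quotient.mk_surjective f
  obtain ⟨s, rfl⟩ := Ideal.Quotient.mk_surjective s
  exact ⟨f, s, (mem_compl s).1 hs, h⟩

lemma iot_zero (f : MvPolynomial (Fin 3) k) (hf : iot k P hP f = 0) :
    ∃ s : MvPolynomial (Fin 3) k, constantCoeff s ≠ 0 ∧ P ∣ s * f := by
  have hf' : algebraMap (MvPolynomial (Fin 3) k ⧸ Ideal.span {P})
      (Localization (rdpMaxIdeal k P hP).primeCompl) (Ideal.Quotient.mk _ f) = 0 := hf
  obtain ⟨⟨s, hs⟩, h⟩ := (IsLocalization.map_eq_zero_iff (rdpMaxIdeal k P hP).primeCompl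
    (Localization (rdpMaxIdeal k P hP).primeCompl) _).1 hf'
  obtain ⟨s, rfl⟩ := Ideal.Quotient.mk_surjective s
  refine ⟨s, (mem_compl s).1 hs, ?_⟩
  rw [← Ideal.mem_span_singleton, ← Ideal.Quotient.eq_zero_iff_mem, map_mul]
  exact h

lemma exists_lift {B : Type u} [CommRing B] [Algebra k B] (h : MvPolynomial (Fin 3) k →ₐ[k] B)
    (h0 : h P = 0) (hu : ∀ f, constantCoeff f ≠ 0 → IsUnit (h f)) :
    ∃ g : rdpLocal k P hP →ₐ[k] B, ∀ f, g (iot k P hP f) = h f := by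
  let h1 : (MvPolynomial (Fin 3) k ⧸ Ideal.span {P}) →ₐ[k] B :=
    Ideal.Quotient.liftₐ (Ideal.span {P}) h (by
      intro a ha
      obtain ⟨c, rfl⟩ := Ideal.mem_span_singleton.1 ha
      rw [map_mul, h0, zero_mul])
  have h1u : ∀ y : (rdpMaxIdeal k P hP).primeCompl, IsUnit (h1 y) := by
    rintro ⟨s, hs⟩
    obtain ⟨s, rfl⟩ := Ideal.Quotient.mk_surjective s
    exact hu s ((mem_compl s).1 hs)
  let g : rdpLocal k P hP →+* B :=
    IsLocalization.lift (M := (rdpMaxIdeal k P hP).primeCompl)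
      (S := Localization (rdpMaxIdeal k P hP).primeCompl) (g := h1.toRingHom) h1u
  have hg : ∀ f, g (iot k P hP f) = h f := fun f =>
    IsLocalization.lift_eq (M := (rdpMaxIdeal k P hP).primeCompl)
      (S := Localization (rdpMaxIdeal k P hP).primeCompl) (g := h1.toRingHom) h1u _
  refine ⟨{ g with commutes' := fun c => ?_ }, hg⟩
  have := hg (algebraMap k _ c)
  rw [AlgHom.commutes, AlgHom.commutes] at this
  exact this

lemma hom_ext {B : Type u} [CommRing B] [Algebra k B] (g₁ g₂ : rdpLocal k P hP →ₐ[k] B)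
    (h : ∀ i, g₁ (iot k P hP (X i)) = g₂ (iot k P hP (X i))) : g₁ = g₂ := by
  have h' : g₁.comp (iot k P hP) = g₂.comp (iot k P hP) := by
    ext i
    exact h i
  have h'' : ∀ f, g₁ (iot k P hP f) = g₂ (iot k P hP f) := fun f => DFunLike.congr_fun h' f
  ext r
  obtain ⟨f, s, hs, e⟩ := iot_surj r
  have u := (iot_unit (hP := hP) s hs).map g₁
  apply u.mul_right_cancel
  rw [← map_mul, e, h'', ← e, map_mul, h'']

/-- The algebra map to dual numbers attached to a derivation. -/
def derHom {A : Type u} [CommRing A] [Algebra k A] {B : Type u} [CommRing B] [Algebra k B]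
    (D : Derivation k A A) (α : A →ₐ[k] B) : A →ₐ[k] TrivSqZeroExt B B :=
  AlgHom.ofLinearMap
    { toFun := fun r => TrivSqZeroExt.inl (α r) + TrivSqZeroExt.inr (α (D r))
      map_add' := by intro a b; ext <;> simp
      map_smul' := by intro a b; ext <;> simp }
    (by ext <;> simp)
    (by intro a b; ext <;> simp [mul_comm])

lemma der_ext (D₁ D₂ : Derivation k (rdpLocal k P hP) (rdpLocal k P hP))
    (h : ∀ i, D₁ (iot k P hP (X i)) = D₂ (iot k P hP (X i))) : D₁ = D₂ := by
  have e := hom_ext (derHom D₁ (AlgHom.id k _)) (derHom D₂ (AlgHom.id k _)) (by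
    intro i
    simp [derHom, h])
  ext r
  simpa [derHom] using congrArg TrivSqZeroExt.snd (DFunLike.congr_fun e r)

lemma der_kill {B : Type u} [CommRing B] [Algebra k B]
    (D : Derivation k (rdpLocal k P hP) (rdpLocal k P hP)) (α : rdpLocal k P hP →ₐ[k] B)
    (h : ∀ i, α (D (iot k P hP (X i))) = 0) (r) : α (D r) = 0 := by
  have e := hom_ext (derHom D α) (derHom 0 α) (by
    intro i
    simp [derHom, h])
  simpa [derHom] using congrArg TrivSqZeroExt.snd (DFunLike.congr_fun e r)

lemma exists_der (v : Fin 3 → rdpLocal k P hP)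
    (h0 : aeval (fun i => (TrivSqZeroExt.inl (iot k P hP (X i)) + TrivSqZeroExt.inr (v i) :
      TrivSqZeroExt (rdpLocal k P hP) (rdpLocal k P hP))) P = 0) :
    ∃ D : Derivation k (rdpLocal k P hP) (rdpLocal k P hP), ∀ i, D (iot k P hP (X i)) = v i := by
  let R := rdpLocal k P hP
  let h : MvPolynomial (Fin 3) k →ₐ[k] TrivSqZeroExt R R :=
    aeval (fun i => (TrivSqZeroExt.inl (iot k P hP (X i)) + TrivSqZeroExt.inr (v i)))
  have hfst : (TrivSqZeroExt.fstHom k R R).comp h = iot k P hP := by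
    ext i
    simp [h]
  obtain ⟨g, hg⟩ := exists_lift (hP := hP) h h0 (by
    intro f hf
    rw [TrivSqZeroExt.isUnit_iff_isUnit_fst]
    have := DFunLike.congr_fun hfst f
    change (h f).fst = _ at this
    rw [this]
    exact iot_unit f hf)
  have hgf : (TrivSqZeroExt.fstHom k R R).comp g = AlgHom.id k R := by
    apply hom_ext
    intro i
    simp [hg, h]
    rfl
  have hgf' : ∀ r, (g r).fst = r := fun r => DFunLike.congr_fun hgf r
  refine ⟨Derivation.mk' ((TrivSqZeroExt.sndHom R R).restrictScalars k ∘ₗ g.toLinearMap) ?_, ?_⟩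
  · intro a b
    simp [hgf', mul_comm]
  · intro i
    simp [hg, h]

end RDPA

namespace RDPA
universe u
variable {k : Type u} [Field k]

/-- The equation of the rational double point of type `A_l`. -/
abbrev PA (k : Type u) [Field k] (l : ℕ) : MvPolynomial (Fin 3) k := X 2 ^ (l + 1) - X 0 * X 1

lemma PA_cc (k : Type u) [Field k] (l : ℕ) : constantCoeff (PA k l) = 0 := by simp

/-- The local ring of the rational double point of type `A_l`. -/
abbrev RA (k : Type u) [Field k] (l : ℕ) := rdpLocal k (PA k l) (PA_cc k l)

/-- The structure map for `A_l`. -/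
abbrev iA (k : Type u) [Field k] (l : ℕ) : MvPolynomial (Fin 3) k →ₐ[k] RA k l :=
  iot k (PA k l) (PA_cc k l)

lemma relA (l : ℕ) : iA k l (X 2) ^ (l + 1) = iA k l (X 0) * iA k l (X 1) := by
  have h : iA k l (PA k l) = 0 := iot_P
  rw [map_sub, map_pow, map_mul, sub_eq_zero] at h
  exact h

lemma exists_derA (l : ℕ) (v : Fin 3 → RA k l)
    (h : ((l + 1 : ℕ) : RA k l) * iA k l (X 2) ^ l * v 2 =
      iA k l (X 1) * v 0 + iA k l (X 0) * v 1) :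
    ∃ D : Derivation k (RA k l) (RA k l), ∀ i, D (iA k l (X i)) = v i := by
  apply exists_der
  have h1 := relA (k := k) l
  ext
  · simp
    rw [h1, sub_self]
  · simp
    push_cast at h
    linear_combination h

lemma derA_eq (l : ℕ) (D : Derivation k (RA k l) (RA k l)) :
    ((l + 1 : ℕ) : RA k l) * iA k l (X 2) ^ l * D (iA k l (X 2)) =
      iA k l (X 1) * D (iA k l (X 0)) + iA k l (X 0) * D (iA k l (X 1)) := by
  have h := congrArg D (relA (k := k) l)
  rw [Derivation.leibniz_pow, Derivation.leibniz] at h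
  simp only [smul_eq_mul, nsmul_eq_mul, Nat.add_sub_cancel] at h
  linear_combination h

lemma X0_not_dvd (l : ℕ) : ¬ (X 0 : MvPolynomial (Fin 3) k) ∣ PA k l := by
  intro h
  have h1 : (X 0 : MvPolynomial (Fin 3) k) ∣ X 2 ^ (l + 1) := by
    have := dvd_add h (Dvd.intro (X 1) rfl : (X 0 : MvPolynomial (Fin 3) k) ∣ X 0 * X 1)
    simpa using this
  have h2 := X_prime.dvd_of_dvd_pow h1
  rw [X_dvd_X] at h2
  exact absurd h2 (by decide)

lemma x_cancel (l : ℕ) (r : RA k l) (h : iA k l (X 0) * r = 0) : r = 0 := by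
  obtain ⟨f, s, hs, e⟩ := iot_surj r
  have h1 : iA k l (X 0 * f) = 0 := by
    rw [map_mul, ← e, ← mul_assoc, h, zero_mul]
  obtain ⟨t, ht, g, hg⟩ := iot_zero _ h1
  have hd : (X 0 : MvPolynomial (Fin 3) k) ∣ PA k l * g := ⟨t * f, by rw [← hg]; ring⟩
  rcases X_prime.dvd_or_dvd hd with hd | ⟨g', rfl⟩
  · exact absurd hd (X0_not_dvd l)
  have h2 : t * f = PA k l * g' := by
    apply mul_left_cancel₀ (X_prime (i := (0 : Fin 3)) (R := k)).ne_zero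
    linear_combination hg
  have h3 : iA k l t * iA k l f = 0 := by
    rw [← map_mul, h2, map_mul, show iA k l (PA k l) = 0 from iot_P, zero_mul]
  have ut : IsUnit (iA k l t) := iot_unit t ht
  have us : IsUnit (iA k l s) := iot_unit s hs
  rw [ut.mul_right_eq_zero] at h3
  change r * iA k l s = iA k l f at e
  rw [h3, us.mul_left_eq_zero] at e
  exact e

lemma mem_xy (n : ℕ) (g : MvPolynomial (Fin 3) k)
    (h : g * X 2 ^ n ∈ Ideal.span {(X 0 : MvPolynomial (Fin 3) k), X 1}) :
    g ∈ Ideal.span {(X 0 : MvPolynomial (Fin 3) k), X 1} := by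
  have e : ({(X 0 : MvPolynomial (Fin 3) k), X 1} : Set _) = X '' ({0, 1} : Set (Fin 3)) := by
    simp [Set.image_pair]
  rw [e, mem_ideal_span_X_image] at h ⊢
  intro m hm
  obtain ⟨i, hi, hi'⟩ := h (m + Finsupp.single 2 n) (by
    rw [X_pow_eq_monomial, mem_support_iff, coeff_mul_monomial, mul_one]
    exact mem_support_iff.1 hm)
  refine ⟨i, hi, ?_⟩
  rcases hi with rfl | rfl <;> simpa using hi'

lemma poly_syz (l : ℕ) (a b : MvPolynomial (Fin 3) k) (h : PA k l ∣ X 1 * a + X 0 * b) :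
    ∃ t q, a = X 0 * t + PA k l * q := by
  obtain ⟨g, hg⟩ := h
  have hm : g ∈ Ideal.span {(X 0 : MvPolynomial (Fin 3) k), X 1} := by
    apply mem_xy (l + 1)
    rw [Ideal.mem_span_pair]
    exact ⟨b + X 1 * g, a, by linear_combination hg⟩
  obtain ⟨g1, g2, rfl⟩ := Ideal.mem_span_pair.1 hm
  have hd : (X 0 : MvPolynomial (Fin 3) k) ∣ X 1 * (a - g2 * X 2 ^ (l + 1)) :=
    ⟨g1 * X 2 ^ (l + 1) - X 1 * (g1 * X 0 + g2 * X 1) - b, by linear_combination hg⟩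
  rcases X_prime.dvd_or_dvd hd with hd | ⟨w, hw⟩
  · rw [X_dvd_X] at hd
    exact absurd hd (by decide)
  · exact ⟨w + X 1 * g2, g2, by linear_combination hw⟩

lemma syz (l : ℕ) (a b : RA k l) (h : iA k l (X 1) * a + iA k l (X 0) * b = 0) :
    ∃ t, a = iA k l (X 0) * t ∧ b = - (iA k l (X 1) * t) := by
  obtain ⟨a', s, hs, ea⟩ := iot_surj a
  obtain ⟨b', s', hs', eb⟩ := iot_surj b
  change a * iA k l s = iA k l a' at ea
  change b * iA k l s' = iA k l b' at eb
  have h1 : iA k l (X 1 * (a' * s') + X 0 * (b' * s)) = 0 := by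
    simp only [map_add, map_mul, ← ea, ← eb]
    linear_combination iA k l s * iA k l s' * h
  obtain ⟨w, hw, hd⟩ := iot_zero _ h1
  obtain ⟨t, q, ht⟩ := poly_syz l (w * (a' * s')) (w * (b' * s)) (by
    convert hd using 1; ring)
  have h2 := congrArg (iA k l) ht
  simp only [map_add, map_mul (iA k l), show iA k l (PA k l) = 0 from iot_P, ← ea] at h2
  have u : IsUnit (iA k l (w * s * s')) := iot_unit _ (by simp [hw, hs, hs'])
  obtain ⟨u, hu⟩ := u
  have hu' : (u : RA k l) * (↑u⁻¹ : RA k l) = 1 := u.mul_inv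
  rw [hu, map_mul, map_mul] at hu'
  have ha : a = iA k l (X 0) * (iA k l t * (↑u⁻¹ : RA k l)) := by
    linear_combination (↑u⁻¹ : RA k l) * h2 - a * hu'
  refine ⟨_, ha, ?_⟩
  rw [← add_eq_zero_iff_eq_neg]
  apply x_cancel
  rw [ha] at h
  linear_combination h

/-- Evaluation at the closed point. -/
lemma exists_curve (l : ℕ) {B : Type u} [CommRing B] [Algebra k B] (e : B →ₐ[k] k)
    (hu : ∀ b, e b ≠ 0 → IsUnit b) (v : Fin 3 → B) (hv : ∀ i, e (v i) = 0)
    (hr : v 2 ^ (l + 1) = v 0 * v 1) :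
    ∃ g : RA k l →ₐ[k] B, ∀ i, g (iA k l (X i)) = v i := by
  have he : e.comp (aeval v) = aeval (0 : Fin 3 → k) := by
    ext i
    simp [hv]
  obtain ⟨g, hg⟩ := exists_lift (hP := PA_cc k l) (aeval v : MvPolynomial (Fin 3) k →ₐ[k] B)
    (by simp [hr]) (by
      intro f hf
      apply hu
      have := DFunLike.congr_fun he f
      simp only [AlgHom.comp_apply] at this
      rw [this]
      simpa [aeval_zero] using hf)
  exact ⟨g, fun i => by simpa using hg (X i)⟩

lemma exists_eps (l : ℕ) : ∃ e : RA k l →ₐ[k] k, ∀ i, e (iA k l (X i)) = 0 :=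
  exists_curve l (AlgHom.id k k) (fun b hb => hb.isUnit) (fun _ => 0) (by simp) (by simp)

/-- Constant coefficient of power series as an algebra map. -/
def psE (k : Type u) [Field k] : PowerSeries k →ₐ[k] k :=
  { (PowerSeries.constantCoeff : PowerSeries k →+* k) with
    commutes' := fun c => by
      change PowerSeries.constantCoeff (algebraMap k (PowerSeries k) c) = c
      simp [PowerSeries.algebraMap_apply] }

lemma psE_apply (f : PowerSeries k) : psE k f = PowerSeries.constantCoeff f := rfl

lemma psE_unit (f : PowerSeries k) (h : psE k f ≠ 0) : IsUnit f := by
  rw [PowerSeries.isUnit_iff_constantCoeff]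
  exact IsUnit.mk0 _ h

lemma kill0 (l : ℕ) (hl : 1 ≤ l) (e : RA k l →ₐ[k] k)
    (he : ∀ i, e (iA k l (X i)) = 0) (D : Derivation k (RA k l) (RA k l)) :
    e (D (iA k l (X 0))) = 0 := by
  obtain ⟨g, hg⟩ := exists_curve l (psE k) psE_unit ![0, PowerSeries.X, 0]
    (by intro i; fin_cases i <;> simp [psE_apply]) (by simp)
  have hge : (psE k).comp g = e := hom_ext _ _ (by
    intro i
    rw [AlgHom.comp_apply, hg, he]
    fin_cases i <;> simp [psE_apply])
  have h := congrArg g (derA_eq l D)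
  simp only [map_add, map_mul, map_pow, hg] at h
  have hl' : l ≠ 0 := by omega
  simp [hl', PowerSeries.X_ne_zero] at h
  rw [← hge, AlgHom.comp_apply, h, map_zero]

lemma kill1 (l : ℕ) (hl : 1 ≤ l) (e : RA k l →ₐ[k] k)
    (he : ∀ i, e (iA k l (X i)) = 0) (D : Derivation k (RA k l) (RA k l)) :
    e (D (iA k l (X 1))) = 0 := by
  obtain ⟨g, hg⟩ := exists_curve l (psE k) psE_unit ![PowerSeries.X, 0, 0]
    (by intro i; fin_cases i <;> simp [psE_apply]) (by simp)
  have hge : (psE k).comp g = e := hom_ext _ _ (by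
    intro i
    rw [AlgHom.comp_apply, hg, he]
    fin_cases i <;> simp [psE_apply])
  have h := congrArg g (derA_eq l D)
  simp only [map_add, map_mul, map_pow, hg] at h
  have hl' : l ≠ 0 := by omega
  simp [hl', PowerSeries.X_ne_zero] at h
  rw [← hge, AlgHom.comp_apply, h, map_zero]

lemma kill2 (l : ℕ) (hn : ((l + 1 : ℕ) : k) ≠ 0) (e : RA k l →ₐ[k] k)
    (he : ∀ i, e (iA k l (X i)) = 0) (D : Derivation k (RA k l) (RA k l)) :
    e (D (iA k l (X 2))) = 0 := by
  let I : Ideal (PowerSeries k) := Ideal.span {PowerSeries.X ^ (l + 1)}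
  let q : (PowerSeries k ⧸ I) →ₐ[k] k := Ideal.Quotient.liftₐ I (psE k) (by
    intro a ha
    obtain ⟨c, rfl⟩ := Ideal.mem_span_singleton.1 ha
    simp [psE_apply])
  have hq : ∀ f, q (Ideal.Quotient.mk I f) = PowerSeries.constantCoeff f := fun f => rfl
  obtain ⟨g, hg⟩ := exists_curve l q (by
      intro b hb
      obtain ⟨b, rfl⟩ := Ideal.Quotient.mk_surjective b
      exact (psE_unit b hb).map _) ![0, 0, Ideal.Quotient.mk I PowerSeries.X]
    (by intro i; fin_cases i <;> simp [hq]) (by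
      simp [← map_pow, Ideal.Quotient.eq_zero_iff_mem, I, Ideal.mem_span_singleton])
  have hge : q.comp g = e := hom_ext _ _ (by
    intro i
    rw [AlgHom.comp_apply, hg, he]
    fin_cases i <;> simp [hq])
  have h := congrArg g (derA_eq l D)
  simp only [map_add, map_mul, map_pow, hg] at h
  rw [← hge, AlgHom.comp_apply]
  obtain ⟨f, hf⟩ := Ideal.Quotient.mk_surjective (g (D (iA k l (X 2))))
  rw [← hf] at h ⊢
  rw [hq]
  have h2 : Ideal.Quotient.mk I (((l + 1 : ℕ) : PowerSeries k) * PowerSeries.X ^ l * f) = 0 := by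
    simpa using h
  rw [Ideal.Quotient.eq_zero_iff_mem, Ideal.mem_span_singleton] at h2
  obtain ⟨c, hc⟩ := h2
  have h3 : ((l + 1 : ℕ) : PowerSeries k) * f = PowerSeries.X * c := by
    apply mul_left_cancel₀ (pow_ne_zero l (PowerSeries.X_ne_zero (R := k)))
    linear_combination hc
  have h4 := congrArg PowerSeries.constantCoeff h3
  rw [map_mul, map_mul, map_natCast] at h4
  simpa [-Nat.cast_add, hn] using h4

lemma kill (l : ℕ) (hl : 1 ≤ l) (hn : ((l + 1 : ℕ) : k) ≠ 0) (e : RA k l →ₐ[k] k)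
    (he : ∀ i, e (iA k l (X i)) = 0) (D : Derivation k (RA k l) (RA k l))
    (r : RA k l) : e (D r) = 0 := by
  apply der_kill
  intro i
  fin_cases i
  · exact kill0 l hl e he D
  · exact kill1 l hl e he D
  · exact kill2 l hn e he D

lemma not_unit (l : ℕ) (hl : 1 ≤ l) (hn : ((l + 1 : ℕ) : k) ≠ 0)
    (D : Derivation k (RA k l) (RA k l)) (r : RA k l) : ¬ IsUnit (D r) := by
  intro h
  obtain ⟨e, he⟩ := exists_eps (k := k) l
  have := h.map e
  rw [kill l hl hn e he D r] at this
  exact not_isUnit_zero this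

lemma exists_D (l : ℕ) (j : Fin 3) :
    ∃ D : Derivation k (RA k l) (RA k l), D (iA k l (X 2)) = iA k l (X j) := by
  have h := relA (k := k) l
  fin_cases j
  · obtain ⟨D, hD⟩ := exists_derA l ![0, ((l + 1 : ℕ) : RA k l) * iA k l (X 2) ^ l, iA k l (X 0)]
      (by simp; ring)
    exact ⟨D, by simpa using hD 2⟩
  · obtain ⟨D, hD⟩ := exists_derA l ![((l + 1 : ℕ) : RA k l) * iA k l (X 2) ^ l, 0, iA k l (X 1)]
      (by simp; ring)
    exact ⟨D, by simpa using hD 2⟩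
  · obtain ⟨D, hD⟩ := exists_derA l ![((l + 1 : ℕ) : RA k l) * iA k l (X 0), 0, iA k l (X 2)]
      (by
        simp
        linear_combination ((l : RA k l) + 1) * h)
    exact ⟨D, by simpa using hD 2⟩

/-- Coordinates of a derivation. -/
def evT (k : Type u) [Field k] (l : ℕ) :
    Derivation k (RA k l) (RA k l) →ₗ[RA k l] (Fin 2 → RA k l) where
  toFun D := ![D (iA k l (X 0)), D (iA k l (X 2))]
  map_add' D E := by ext i; fin_cases i <;> simp
  map_smul' r D := by ext i; fin_cases i <;> simp

lemma evT_inj (l : ℕ) : Function.Injective (evT k l) := by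
  intro D E h
  have h0 : D (iA k l (X 0)) = E (iA k l (X 0)) := congrFun h 0
  have h2 : D (iA k l (X 2)) = E (iA k l (X 2)) := congrFun h 1
  apply der_ext
  intro i
  fin_cases i
  · exact h0
  · have hD := derA_eq l D
    have hE := derA_eq l E
    rw [h0, h2] at hD
    apply sub_eq_zero.1
    apply x_cancel
    change iA k l (X 0) * (D (iA k l (X 1)) - E (iA k l (X 1))) = 0
    linear_combination hE - hD
  · exact h2

lemma not_free (l : ℕ) (hl : 1 ≤ l) (hn : ((l + 1 : ℕ) : k) ≠ 0) :
    ¬ Module.Free (RA k l) (Derivation k (RA k l) (RA k l)) := by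
  intro hfree
  obtain ⟨e, he⟩ := exists_eps (k := k) l
  have : Nontrivial (RA k l) := e.toRingHom.domain_nontrivial
  have hrank := LinearMap.rank_le_of_injective _ (evT_inj (k := k) l)
  rw [rank_fin_fun, Module.Free.rank_eq_card_chooseBasisIndex] at hrank
  let b := Module.Free.chooseBasis (RA k l) (Derivation k (RA k l) (RA k l))
  have hfin : Finite (Module.Free.ChooseBasisIndex (RA k l) (Derivation k (RA k l) (RA k l))) :=
    Cardinal.lt_aleph0_iff_finite.1 (hrank.trans_lt Cardinal.natCast_lt_aleph0)
  have := Fintype.ofFinite (Module.Free.ChooseBasisIndex (RA k l) (Derivation k (RA k l) (RA k l)))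
  rw [Cardinal.mk_fintype, Nat.cast_le] at hrank
  obtain ⟨g, hg⟩ := exists_curve l (TrivSqZeroExt.fstHom k k (Fin 3 → k))
    (by
      intro x hx
      rw [TrivSqZeroExt.isUnit_iff_isUnit_fst]
      exact IsUnit.mk0 _ hx)
    (fun i => TrivSqZeroExt.inr (Pi.single i 1)) (by simp)
    (by
      obtain ⟨m, rfl⟩ : ∃ m, l = m + 1 := ⟨l - 1, by omega⟩
      rw [pow_succ, pow_succ, mul_assoc]
      simp)
  have hge : (TrivSqZeroExt.fstHom k k (Fin 3 → k)).comp g = e := hom_ext _ _ (by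
    intro i
    rw [AlgHom.comp_apply, hg, he]
    simp)
  have hfst : ∀ D : Derivation k (RA k l) (RA k l), (g (D (iA k l (X 2)))).fst = 0 := by
    intro D
    rw [← kill l hl hn e he D (iA k l (X 2)), ← hge]
    rfl
  let w := fun i => (g (b i (iA k l (X 2)))).snd
  have hspan : Submodule.span k (Set.range w) = ⊤ := by
    rw [eq_top_iff, ← (Pi.basisFun k (Fin 3)).span_eq, Submodule.span_le]
    rintro _ ⟨j, rfl⟩
    obtain ⟨D, hD⟩ := exists_D (k := k) l j
    have h1 : (g (D (iA k l (X 2)))).snd = Pi.single j 1 := by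
      rw [hD, hg]; simp
    rw [Pi.basisFun_apply, ← h1, ← b.sum_repr D]
    have h2 : (∑ i, b.repr D i • b i) (iA k l (X 2)) =
        ∑ i, b.repr D i * b i (iA k l (X 2)) := by
      rw [← Derivation.coeFnAddMonoidHom_apply, map_sum, Finset.sum_apply]
      rfl
    rw [h2, map_sum, TrivSqZeroExt.snd_sum]
    refine Submodule.sum_mem _ fun i _ => ?_
    rw [map_mul, TrivSqZeroExt.snd_mul, hfst]
    simp only [MulOpposite.op_zero, zero_smul, add_zero]
    exact Submodule.smul_mem _ _ (Submodule.subset_span ⟨i, rfl⟩)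
  have h3 := finrank_range_le_card (R := k) w
  rw [Set.finrank, hspan, finrank_top, Module.finrank_fin_fun] at h3
  omega

lemma castR (l : ℕ) (hn : ((l + 1 : ℕ) : k) = 0) :
    ((l + 1 : ℕ) : RA k l) = 0 := by
  rw [← map_natCast (algebraMap k (RA k l)), hn, map_zero]

lemma exists_Z (l : ℕ) (hn : ((l + 1 : ℕ) : k) = 0) :
    ∃ D : Derivation k (RA k l) (RA k l), ∀ i, D (iA k l (X i)) =
    (![0, 0, 1] : Fin 3 → RA k l) i :=
  exists_derA l _ (by rw [castR l hn]; simp)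

lemma exists_E (l : ℕ) (hn : ((l + 1 : ℕ) : k) = 0) :
    ∃ D : Derivation k (RA k l) (RA k l), ∀ i, D (iA k l (X i)) =
    (![iA k l (X 0), - iA k l (X 1), 0] : Fin 3 → RA k l) i :=
  exists_derA l _ (by rw [castR l hn]; simp; ring)

lemma is_free (l : ℕ) (hn : ((l + 1 : ℕ) : k) = 0) :
    Module.Free (RA k l) (Derivation k (RA k l) (RA k l)) := by
  obtain ⟨Z, hZ⟩ := exists_Z (k := k) l hn
  obtain ⟨E, hE⟩ := exists_E (k := k) l hn
  let T : (RA k l × RA k l) →ₗ[RA k l] Derivation k (RA k l) (RA k l) :=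
    (LinearMap.toSpanSingleton _ _ E).coprod (LinearMap.toSpanSingleton _ _ Z)
  have hT : ∀ t c r, T (t, c) r = t * E r + c * Z r := by
    intro t c r
    simp [T]
  refine Module.Free.of_equiv (LinearEquiv.ofBijective T ⟨?_, ?_⟩)
  · rw [← LinearMap.ker_eq_bot, LinearMap.ker_eq_bot']
    rintro ⟨t, c⟩ h
    have h0 := hT t c (iA k l (X 0))
    have h2 := hT t c (iA k l (X 2))
    rw [h, hE, hZ] at h0 h2
    simp at h0 h2
    ext
    · exact x_cancel l t (by rw [mul_comm]; first | exact h0 | exact h0.symm)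
    · exact h2.symm
  · intro D
    have h := derA_eq l D
    rw [castR l hn, zero_mul, zero_mul] at h
    obtain ⟨t, h0, h1⟩ := syz l _ _ h.symm
    refine ⟨(t, D (iA k l (X 2))), ?_⟩
    apply der_ext
    intro i
    change T _ (iA k l (X i)) = D (iA k l (X i))
    rw [hT, hE, hZ]
    fin_cases i
    · simp [h0, mul_comm]
    · simp [h1, mul_comm]
    · simp

end RDPA

/-- For the rational double point `R` of type `A_l` in characteristic `p > 0`, given by
`z^{l+1} - x·y = 0`: (a) the module `Der_k(R)` of `k`-linear derivations is free iff
`p ∣ l + 1`; (b) there exist a derivation `D` and an element `f` with `D f` a unit iff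
`p ∣ l + 1`. -/
theorem rdp_A_tangent_free_and_pairing_iff (k : Type*) [Field k] (p : ℕ) (hp : p.Prime)
    [CharP k p] (l : ℕ) (hl : 1 ≤ l) :
    let R := rdpLocal k (X 2 ^ (l + 1) - X 0 * X 1) (by simp)
    (Module.Free R (Derivation k R R) ↔ p ∣ (l + 1)) ∧
      ((∃ (D : Derivation k R R) (f : R), IsUnit (D f)) ↔ p ∣ (l + 1)) := by
  intro R
  rw [← CharP.cast_eq_zero_iff k p (l + 1)]
  refine ⟨⟨fun h => ?_, fun h => RDPA.is_free l h⟩, ⟨fun h => ?_, fun h => ?_⟩⟩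
  · by_contra hn
    exact RDPA.not_free l hl hn h
  · obtain ⟨D, f, h⟩ := h
    by_contra hn
    exact RDPA.not_unit l hl hn D f h
  · obtain ⟨D, hD⟩ := RDPA.exists_Z (k := k) l h
    refine ⟨D, RDPA.iA k l (X 2), ?_⟩
    have h2 : D (RDPA.iA k l (X 2)) = 1 := hD 2
    rw [h2]
    exact isUnit_one
end
end

section
/- Let k be a field of characteristic p ≥ 3 and let l ≥ 4 be an integer. Let R be the localization of the ring k[x,y,z]/(z² + x²·y + x·y^{l-1}) at the maximal ideal generated by the images of x, y, z (the rational double point of type D_l in odd characteristic). Then the R-module Der_k(R) of k-linear derivations of R is not free, and there exist no k-linear derivation D of R and element f ∈ R such that D(f) is a unit. -/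
open MvPolynomial

noncomputable section

section Aux

variable {k : Type*} [Field k] {P : MvPolynomial (Fin 3) k} {hP : constantCoeff P = 0}

instance rdpAuxAlg : Algebra (MvPolynomial (Fin 3) k ⧸ Ideal.span {P}) (rdpLocal k P hP) :=
  inferInstanceAs (Algebra (MvPolynomial (Fin 3) k ⧸ Ideal.span {P})
    (Localization (rdpMaxIdeal k P hP).primeCompl))

instance rdpAuxLoc : IsLocalization (rdpMaxIdeal k P hP).primeCompl (rdpLocal k P hP) :=
  Localization.isLocalization (M := (rdpMaxIdeal k P hP).primeCompl)

instance rdpAuxTower :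
    IsScalarTower k (MvPolynomial (Fin 3) k ⧸ Ideal.span {P}) (rdpLocal k P hP) :=
  inferInstanceAs (IsScalarTower k (MvPolynomial (Fin 3) k ⧸ Ideal.span {P})
    (Localization (rdpMaxIdeal k P hP).primeCompl))

/-- The canonical map from the polynomial ring. -/
def rdpCan (k : Type*) [Field k] (P : MvPolynomial (Fin 3) k) (hP : constantCoeff P = 0) :
    MvPolynomial (Fin 3) k →ₐ[k] rdpLocal k P hP :=
  (IsScalarTower.toAlgHom k (MvPolynomial (Fin 3) k ⧸ Ideal.span {P}) (rdpLocal k P hP)).comp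
    (Ideal.Quotient.mkₐ k _)

lemma rdpCan_P : rdpCan k P hP P = 0 := by
  have : (Ideal.Quotient.mkₐ k (Ideal.span {P})) P = 0 := by
    simp [Ideal.Quotient.eq_zero_iff_mem, Ideal.mem_span_singleton]
  simp only [rdpCan, AlgHom.comp_apply, this, map_zero]

lemma rdp_hom_ext {T : Type*} [CommRing T] [Algebra k T] {f g : rdpLocal k P hP →ₐ[k] T}
    (h : ∀ i, f (rdpCan k P hP (X i)) = g (rdpCan k P hP (X i))) : f = g := by
  have h1 : f.comp (rdpCan k P hP) = g.comp (rdpCan k P hP) := MvPolynomial.algHom_ext h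
  apply AlgHom.coe_ringHom_injective
  apply IsLocalization.ringHom_ext (rdpMaxIdeal k P hP).primeCompl
  apply Ideal.Quotient.ringHom_ext
  apply RingHom.ext
  intro a
  exact DFunLike.congr_fun h1 a

lemma rdp_lift {T : Type*} [CommRing T] [Algebra k T] (π : T →ₐ[k] k)
    (hπ : ∀ t, π t ≠ 0 → IsUnit t) (q : Fin 3 → T) (hq : ∀ i, π (q i) = 0)
    (hqP : aeval q P = 0) :
    ∃ φ : rdpLocal k P hP →ₐ[k] T, ∀ i, φ (rdpCan k P hP (X i)) = q i := by
  have hc : ∀ s, π (aeval q s) = constantCoeff s := by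
    intro s
    have : π.comp (aeval q) = (aeval (fun _ => (0 : k))) := by
      apply MvPolynomial.algHom_ext; intro i; simp [hq]
    have h2 := DFunLike.congr_fun this s
    simp only [AlgHom.comp_apply] at h2
    rw [h2, MvPolynomial.aeval_zero']
    rfl
  let f : (MvPolynomial (Fin 3) k ⧸ Ideal.span {P}) →ₐ[k] T :=
    Ideal.Quotient.liftₐ _ (aeval q) (by
      intro a ha
      rw [Ideal.mem_span_singleton] at ha
      obtain ⟨c, rfl⟩ := ha
      rw [map_mul, hqP, zero_mul])
  have hf : ∀ y : (rdpMaxIdeal k P hP).primeCompl, IsUnit (f y) := by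
    rintro ⟨y, hy⟩
    obtain ⟨s, rfl⟩ := Ideal.Quotient.mk_surjective y
    apply hπ
    have h1 : f (Ideal.Quotient.mk _ s) = aeval q s := rfl
    simp only [h1, hc]
    exact hy
  refine ⟨IsLocalization.liftAlgHom (S := rdpLocal k P hP) hf, fun i => ?_⟩
  have : rdpCan k P hP (X i) = algebraMap _ (rdpLocal k P hP) (Ideal.Quotient.mk (Ideal.span {P}) (X i)) := rfl
  rw [this, IsLocalization.liftAlgHom_apply, IsLocalization.lift_eq]
  change aeval q (X i) = q i
  simp

lemma rdp_res : ∃ ρ : rdpLocal k P hP →ₐ[k] k, (∀ i, ρ (rdpCan k P hP (X i)) = 0) ∧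
    ∀ r, ρ r ≠ 0 → IsUnit r := by
  obtain ⟨ρ, hρ⟩ := rdp_lift (P := P) (hP := hP) (AlgHom.id k k) (fun t ht => ht.isUnit)
    (fun _ => 0) (by simp) (by rw [MvPolynomial.aeval_zero']; simp [hP])
  refine ⟨ρ, hρ, fun r hr => ?_⟩
  obtain ⟨a, s, rfl⟩ := IsLocalization.exists_mk'_eq (rdpMaxIdeal k P hP).primeCompl r
  rw [IsLocalization.AtPrime.isUnit_mk'_iff (rdpLocal k P hP) (rdpMaxIdeal k P hP)]
  intro ha
  apply hr
  obtain ⟨b, rfl⟩ := Ideal.Quotient.mk_surjective a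
  have hb : constantCoeff b = 0 := ha
  have h1 : ρ (rdpCan k P hP b) = 0 := by
    have : ρ.comp (rdpCan k P hP) = (aeval (fun _ => (0 : k))) := by
      apply MvPolynomial.algHom_ext; intro i; simp [hρ]
    have h2 := DFunLike.congr_fun this b
    simp only [AlgHom.comp_apply] at h2
    rw [h2, MvPolynomial.aeval_zero']
    simp [hb]
  have h3 := IsLocalization.mk'_spec (rdpLocal k P hP) (Ideal.Quotient.mk _ b) s
  have h4 := congrArg ρ h3
  rw [map_mul] at h4
  have h5 : ρ (algebraMap _ (rdpLocal k P hP) (Ideal.Quotient.mk (Ideal.span {P}) b)) = 0 := h1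
  rw [h5] at h4
  have h6 := (IsLocalization.map_units (rdpLocal k P hP) s).map ρ
  exact (mul_eq_zero.mp h4).resolve_right h6.ne_zero

open TrivSqZeroExt in
/-- The algebra map to the dual numbers attached to a derivation and a hom. -/
def rdpDerHom {R : Type*} [CommRing R] [Algebra k R] {T : Type*} [CommRing T] [Algebra k T]
    (ρ : R →ₐ[k] T) (D : Derivation k R R) : R →ₐ[k] DualNumber T :=
  AlgHom.ofLinearMap
    { toFun := fun r => (inl (ρ r) + inr (ρ (D r)) : DualNumber T)
      map_add' := by intro a b; ext <;> simp
      map_smul' := by intro a b; ext <;> simp }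
    (by ext <;> simp) (by intro a b; ext <;> simp [mul_comm])

lemma rdpDerHom_fst {R : Type*} [CommRing R] [Algebra k R] {T : Type*} [CommRing T] [Algebra k T]
    (ρ : R →ₐ[k] T) (D : Derivation k R R) (r : R) : (rdpDerHom ρ D r).fst = ρ r := by
  simp [rdpDerHom]

lemma rdpDerHom_snd {R : Type*} [CommRing R] [Algebra k R] {T : Type*} [CommRing T] [Algebra k T]
    (ρ : R →ₐ[k] T) (D : Derivation k R R) (r : R) : (rdpDerHom ρ D r).snd = ρ (D r) := by
  simp [rdpDerHom]

lemma rdp_der_zero {T : Type*} [CommRing T] [Algebra k T] (ρ : rdpLocal k P hP →ₐ[k] T)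
    (D : Derivation k (rdpLocal k P hP) (rdpLocal k P hP))
    (h : ∀ i, ρ (D (rdpCan k P hP (X i))) = 0) (r) : ρ (D r) = 0 := by
  have : rdpDerHom ρ D = rdpDerHom ρ 0 := by
    apply rdp_hom_ext
    intro i
    apply TrivSqZeroExt.ext <;> simp [rdpDerHom_fst, rdpDerHom_snd, h]
  rw [← rdpDerHom_snd, this, rdpDerHom_snd]; simp

lemma rdp_der_exists (d : Fin 3 → rdpLocal k P hP)
    (hd : (aeval (fun i => (TrivSqZeroExt.inl (rdpCan k P hP (X i)) + TrivSqZeroExt.inr (d i) :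
      DualNumber (rdpLocal k P hP))) P) = 0) :
    ∃ D : Derivation k (rdpLocal k P hP) (rdpLocal k P hP),
      ∀ i, D (rdpCan k P hP (X i)) = d i := by
  obtain ⟨ρ, hρ, hu⟩ := rdp_res (P := P) (hP := hP)
  obtain ⟨φ, hφ⟩ := rdp_lift (P := P) (hP := hP)
    (ρ.comp (TrivSqZeroExt.fstHom k (rdpLocal k P hP) (rdpLocal k P hP)))
    (by
      intro t ht
      rw [TrivSqZeroExt.isUnit_iff_isUnit_fst]
      exact hu _ ht) _ (by intro i; simp [hρ]) hd
  have hfst : ∀ r, (φ r).fst = r := by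
    have : (TrivSqZeroExt.fstHom k (rdpLocal k P hP) (rdpLocal k P hP)).comp φ =
        AlgHom.id k _ := by
      apply rdp_hom_ext; intro i; simp [hφ]
    exact fun r => DFunLike.congr_fun this r
  refine ⟨Derivation.mk' ((TrivSqZeroExt.sndHom (rdpLocal k P hP) (rdpLocal k P hP)).restrictScalars k ∘ₗ φ.toLinearMap) ?_, ?_⟩
  · intro a b
    simp [hfst, mul_comm]
  · intro i
    simp [hφ]

end Aux

section Main

variable {k : Type*} [Field k] {n : ℕ}

/-- The equation. -/
abbrev rdpD (k : Type*) [Field k] (n : ℕ) : MvPolynomial (Fin 3) k :=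
  X 2 ^ 2 + X 0 ^ 2 * X 1 + X 0 * X 1 ^ n

lemma rdpD_z_inj {hP : constantCoeff (rdpD k n) = 0} (r : rdpLocal k (rdpD k n) hP)
    (h : rdpCan k (rdpD k n) hP (X 2) * r = 0) : r = 0 := by
  have hz : Ideal.Quotient.mk (Ideal.span {rdpD k n}) (X 2) ∈ nonZeroDivisors _ := by
    rw [mem_nonZeroDivisors_iff_right]
    intro y hy
    obtain ⟨y, rfl⟩ := Ideal.Quotient.mk_surjective y
    rw [← map_mul, Ideal.Quotient.eq_zero_iff_mem, Ideal.mem_span_singleton] at hy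
    rw [Ideal.Quotient.eq_zero_iff_mem, Ideal.mem_span_singleton]
    obtain ⟨c, hc⟩ := hy
    have hpr : Prime (X 2 : MvPolynomial (Fin 3) k) := MvPolynomial.X_prime
    have h1 : (X 2 : MvPolynomial (Fin 3) k) ∣ rdpD k n * c := ⟨y, by rw [← hc, mul_comm]⟩
    rcases hpr.dvd_or_dvd h1 with h2 | ⟨e, rfl⟩
    · exfalso
      obtain ⟨e, he⟩ := h2
      have h3 := congrArg (aeval (![Polynomial.X, 1, 0] : Fin 3 → Polynomial k)) he
      simp at h3
      have h4 := congrArg (fun p => Polynomial.coeff p 2) h3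
      simp [Polynomial.coeff_X] at h4
    · refine ⟨e, mul_left_cancel₀ hpr.ne_zero ?_⟩
      rw [mul_comm, hc]; ring
  have := IsLocalization.nonZeroDivisors_le_comap (rdpMaxIdeal k (rdpD k n) hP).primeCompl
    (rdpLocal k (rdpD k n) hP) hz
  rw [Submonoid.mem_comap, mem_nonZeroDivisors_iff_right] at this
  apply this
  rw [mul_comm]; exact h

lemma rdpD_rel {hP : constantCoeff (rdpD k n) = 0}
    (D : Derivation k (rdpLocal k (rdpD k n) hP) (rdpLocal k (rdpD k n) hP)) 
    (x y z : rdpLocal k (rdpD k n) hP) (hx : rdpCan k (rdpD k n) hP (X 0) = x)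
    (hy : rdpCan k (rdpD k n) hP (X 1) = y) (hz : rdpCan k (rdpD k n) hP (X 2) = z) :
    (2 * x * y + y ^ n) * D x + (x ^ 2 + n * x * y ^ (n - 1)) * D y + 2 * z * D z = 0 := by
  have h : z ^ 2 + x ^ 2 * y + x * y ^ n = 0 := by
    rw [← hx, ← hy, ← hz]
    simpa using rdpCan_P (k := k) (P := rdpD k n) (hP := hP)
  have h2 := congrArg D h
  simp only [map_add, Derivation.leibniz, Derivation.leibniz_pow, map_zero, smul_eq_mul,
    nsmul_eq_mul] at h2
  rw [← h2]
  push_cast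
  simp only [pow_one]
  ring

lemma rdpD_der {hP : constantCoeff (rdpD k n) = 0}
    (x y z : rdpLocal k (rdpD k n) hP) (hx : rdpCan k (rdpD k n) hP (X 0) = x)
    (hy : rdpCan k (rdpD k n) hP (X 1) = y) (hz : rdpCan k (rdpD k n) hP (X 2) = z)
    (a b c : rdpLocal k (rdpD k n) hP)
    (h : (2 * x * y + y ^ n) * a + (x ^ 2 + n * x * y ^ (n - 1)) * b + 2 * z * c = 0) :
    ∃ D : Derivation k (rdpLocal k (rdpD k n) hP) (rdpLocal k (rdpD k n) hP),
      D x = a ∧ D y = b ∧ D z = c := by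
  have h0 : z ^ 2 + x ^ 2 * y + x * y ^ n = 0 := by
    rw [← hx, ← hy, ← hz]
    simpa using rdpCan_P (k := k) (P := rdpD k n) (hP := hP)
  obtain ⟨D, hD⟩ := rdp_der_exists (P := rdpD k n) (hP := hP) ![a, b, c] (by
    apply TrivSqZeroExt.ext
    · simp [hx, hy, hz, h0]
    · simp [hx, hy, hz, TrivSqZeroExt.snd_pow]
      rw [← h]; ring)
  refine ⟨D, ?_, ?_, ?_⟩
  · rw [← hx, hD]; rfl
  · rw [← hy, hD]; rfl
  · rw [← hz, hD]; rfl


lemma rdpD_mem {hP : constantCoeff (rdpD k n) = 0} (hn : 3 ≤ n) (h2 : (2 : k) ≠ 0)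
    (ρ : rdpLocal k (rdpD k n) hP →ₐ[k] k)
    (hρ : ∀ i, ρ (rdpCan k (rdpD k n) hP (X i)) = 0)
    (D : Derivation k (rdpLocal k (rdpD k n) hP) (rdpLocal k (rdpD k n) hP)) (i : Fin 3) :
    ρ (D (rdpCan k (rdpD k n) hP (X i))) = 0 := by
  have hrel := rdpD_rel D _ _ _ rfl rfl rfl
  have hpu : ∀ t : PowerSeries k, PowerSeries.constantCoeff t ≠ 0 → IsUnit t := by
    intro t ht
    rw [PowerSeries.isUnit_iff_constantCoeff]
    exact ht.isUnit
  let π : PowerSeries k →ₐ[k] k :=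
    { (PowerSeries.constantCoeff : PowerSeries k →+* k) with
      commutes' := fun r => by simp [PowerSeries.algebraMap_apply] }
  have hπ : ∀ t, π t = PowerSeries.constantCoeff t := fun _ => rfl
  have hn0 : n ≠ 0 := by omega
  have hn1 : n - 1 ≠ 0 := by omega
  have key : ∀ (φ : rdpLocal k (rdpD k n) hP →ₐ[k] PowerSeries k),
      (∀ i, π (φ (rdpCan k (rdpD k n) hP (X i))) = 0) → ∀ r, φ r = 0 → ρ r = 0 := by
    intro φ h r hr
    have : π.comp φ = ρ := rdp_hom_ext (by intro i; rw [hρ]; exact h i)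
    rw [← this]; simp [hr]
  fin_cases i
  · obtain ⟨φ, hφ⟩ := rdp_lift (P := rdpD k n) (hP := hP) π hpu ![0, PowerSeries.X, 0]
      (by intro i; fin_cases i <;> simp [hπ]) (by simp)
    apply key φ (by intro i; rw [hφ]; fin_cases i <;> simp [hπ])
    have := congrArg φ hrel
    simpa [hφ, PowerSeries.X_ne_zero] using this
  · obtain ⟨φ, hφ⟩ := rdp_lift (P := rdpD k n) (hP := hP) π hpu ![PowerSeries.X, 0, 0]
      (by intro i; fin_cases i <;> simp [hπ]) (by simp [hn0])
    apply key φ (by intro i; rw [hφ]; fin_cases i <;> simp [hπ])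
    have := congrArg φ hrel
    simpa [hφ, PowerSeries.X_ne_zero, hn0, hn1] using this
  · obtain ⟨φ, hφ⟩ := rdp_lift (P := rdpD k n) (hP := hP) (TrivSqZeroExt.fstHom k k k)
      (by intro t ht; rw [TrivSqZeroExt.isUnit_iff_isUnit_fst]; exact IsUnit.mk0 _ ht)
      ![0, 0, TrivSqZeroExt.inr 1]
      (by intro i; fin_cases i <;> simp) (by simp [pow_two])
    have h3 : (TrivSqZeroExt.fstHom k k k).comp φ = ρ :=
      rdp_hom_ext (by intro i; rw [hρ]; simp [hφ]; fin_cases i <;> simp)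
    have := congrArg φ hrel
    simp [hφ, hn0, hn1] at this
    have := congrArg TrivSqZeroExt.snd this
    rw [← h3]
    have h22 : (φ 2).fst = 2 := by rw [map_ofNat φ 2]; rfl
    simpa [h2, h22] using this

lemma rdpD_two_gen {hP : constantCoeff (rdpD k n) = 0} (h2 : (2 : k) ≠ 0)
    (hF : Module.Free (rdpLocal k (rdpD k n) hP)
      (Derivation k (rdpLocal k (rdpD k n) hP) (rdpLocal k (rdpD k n) hP))) :
    ∃ e : Fin 2 → Derivation k (rdpLocal k (rdpD k n) hP) (rdpLocal k (rdpD k n) hP),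
      ∀ D, ∃ c : Fin 2 → rdpLocal k (rdpD k n) hP, ∑ i, c i • e i = D := by
  obtain ⟨ρ, hρ, hu⟩ := rdp_res (P := rdpD k n) (hP := hP)
  haveI : Nontrivial (rdpLocal k (rdpD k n) hP) := ρ.toRingHom.domain_nontrivial
  let x := fun i => rdpCan k (rdpD k n) hP (X i)
  let L : Derivation k (rdpLocal k (rdpD k n) hP) (rdpLocal k (rdpD k n) hP)
      →ₗ[rdpLocal k (rdpD k n) hP] (Fin 2 → rdpLocal k (rdpD k n) hP) :=
    { toFun := fun D => ![D (x 0), D (x 1)]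
      map_add' := by intro a b; ext i; fin_cases i <;> simp
      map_smul' := by intro a b; ext i; fin_cases i <;> simp }
  have hL : Function.Injective L := by
    rw [injective_iff_map_eq_zero]
    intro D hD
    have h0 : D (x 0) = 0 := congrFun hD 0
    have h1 : D (x 1) = 0 := congrFun hD 1
    have hrel := rdpD_rel D (x 0) (x 1) (x 2) rfl rfl rfl
    rw [h0, h1, mul_zero, mul_zero, zero_add, zero_add, mul_assoc, mul_left_comm] at hrel
    have h3 := rdpD_z_inj _ hrel
    have hu2 : IsUnit (2 : rdpLocal k (rdpD k n) hP) := hu _ (by rw [map_ofNat ρ 2]; exact h2)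
    have h4 : D (x 2) = 0 := by
      rwa [hu2.mul_right_eq_zero] at h3
    ext r
    exact rdp_der_zero (AlgHom.id k _) D (by intro i; fin_cases i; exacts [h0, h1, h4]) r
  let b := Module.Free.chooseBasis (rdpLocal k (rdpD k n) hP)
    (Derivation k (rdpLocal k (rdpD k n) hP) (rdpLocal k (rdpD k n) hP))
  have hr := LinearMap.rank_le_of_injective L hL
  rw [Module.Free.rank_eq_card_chooseBasisIndex, rank_fin_fun] at hr
  have hr2 : Cardinal.lift.{0} (Cardinal.mk (Module.Free.ChooseBasisIndex (rdpLocal k (rdpD k n) hP)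
    (Derivation k (rdpLocal k (rdpD k n) hP) (rdpLocal k (rdpD k n) hP)))) ≤
      Cardinal.lift (Cardinal.mk (Fin 2)) := by simpa using hr
  obtain ⟨g⟩ := Cardinal.lift_mk_le'.mp hr2
  refine ⟨Function.extend g b 0, fun D => ?_⟩
  rw [← Submodule.mem_span_range_iff_exists_fun]
  have : Submodule.span (rdpLocal k (rdpD k n) hP) (Set.range b) ≤
      Submodule.span (rdpLocal k (rdpD k n) hP) (Set.range (Function.extend g b 0)) := by
    apply Submodule.span_mono
    rintro _ ⟨i, rfl⟩
    exact ⟨g i, g.injective.extend_apply _ _ _⟩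
  apply this
  rw [b.span_eq]; trivial

lemma rdpD_not_free {hP : constantCoeff (rdpD k n) = 0} (hn : 3 ≤ n) (h2 : (2 : k) ≠ 0) :
    ¬ Module.Free (rdpLocal k (rdpD k n) hP)
      (Derivation k (rdpLocal k (rdpD k n) hP) (rdpLocal k (rdpD k n) hP)) := by
  intro hF
  obtain ⟨e, he⟩ := rdpD_two_gen h2 hF
  obtain ⟨ρ, hρ, hu⟩ := rdp_res (P := rdpD k n) (hP := hP)
  have hn0 : n ≠ 0 := by omega
  have hn1 : n - 1 ≠ 0 := by omega
  obtain ⟨x, hx⟩ : ∃ x, rdpCan k (rdpD k n) hP (X 0) = x := ⟨_, rfl⟩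
  obtain ⟨y, hy⟩ : ∃ x, rdpCan k (rdpD k n) hP (X 1) = x := ⟨_, rfl⟩
  obtain ⟨z, hz⟩ : ∃ x, rdpCan k (rdpD k n) hP (X 2) = x := ⟨_, rfl⟩
  obtain ⟨D1, h1x, h1y, -⟩ := rdpD_der x y z hx hy hz (2 * z) 0 (-(2 * x * y + y ^ n)) (by ring)
  obtain ⟨D2, h2x, h2y, -⟩ := rdpD_der x y z hx hy hz 0 (2 * z)
    (-(x ^ 2 + n * x * y ^ (n - 1))) (by ring)
  obtain ⟨D3, h3x, -, -⟩ := rdpD_der x y z hx hy hz (x ^ 2 + n * x * y ^ (n - 1))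
    (-(2 * x * y + y ^ n)) 0 (by ring)
  obtain ⟨u, hu1⟩ := he D1
  obtain ⟨v, hv1⟩ := he D2
  obtain ⟨w, hw1⟩ := he D3
  have ex : ∀ j, ρ (e j x) = 0 := fun j => hx ▸ rdpD_mem hn h2 ρ hρ (e j) 0
  have ey : ∀ j, ρ (e j y) = 0 := fun j => hy ▸ rdpD_mem hn h2 ρ hρ (e j) 1
  have E1 : u 0 * e 0 x + u 1 * e 1 x = 2 * z := by
    rw [← h1x, ← hu1]; simp [Fin.sum_univ_two]
  have E2 : u 0 * e 0 y + u 1 * e 1 y = 0 := by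
    rw [← h1y, ← hu1]; simp [Fin.sum_univ_two]
  have E3 : v 0 * e 0 x + v 1 * e 1 x = 0 := by
    rw [← h2x, ← hv1]; simp [Fin.sum_univ_two]
  have E4 : v 0 * e 0 y + v 1 * e 1 y = 2 * z := by
    rw [← h2y, ← hv1]; simp [Fin.sum_univ_two]
  have E5 : w 0 * e 0 x + w 1 * e 1 x = x ^ 2 + n * x * y ^ (n - 1) := by
    rw [← h3x, ← hw1]; simp [Fin.sum_univ_two]
  have hdet : ρ (u 0 * v 1 - u 1 * v 0) ≠ 0 := by
    obtain ⟨φ, hφ⟩ := rdp_lift (P := rdpD k n) (hP := hP) (TrivSqZeroExt.fstHom k k k)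
      (by intro t ht; rw [TrivSqZeroExt.isUnit_iff_isUnit_fst]; exact IsUnit.mk0 _ ht)
      ![0, 0, TrivSqZeroExt.inr 1]
      (by intro i; fin_cases i <;> simp) (by simp [pow_two])
    have h3 : (TrivSqZeroExt.fstHom k k k).comp φ = ρ :=
      rdp_hom_ext (by intro i; rw [hρ]; simp [hφ]; fin_cases i <;> simp)
    have h4 : ∀ r, (φ r).fst = ρ r := fun r => DFunLike.congr_fun h3 r
    have hzz : (φ z).snd = 1 := by rw [← hz, hφ]; simp
    have hz0 : ρ z = 0 := by rw [← hz, hρ]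
    have hr2 : ρ 2 = 2 := map_ofNat ρ 2
    have F1 := congrArg (fun r => (φ r).snd) E1
    have F2 := congrArg (fun r => (φ r).snd) E2
    have F3 := congrArg (fun r => (φ r).snd) E3
    have F4 := congrArg (fun r => (φ r).snd) E4
    simp [h4, ex, ey, hzz, hz0, hr2] at F1 F2 F3 F4
    intro h0
    simp only [map_sub, map_mul] at h0
    have : (2 : k) * 2 = 0 := by
      generalize (φ (e 0 x)).snd = a0 at *
      generalize (φ (e 1 x)).snd = a1 at *
      generalize (φ (e 0 y)).snd = b0 at *
      generalize (φ (e 1 y)).snd = b1 at *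
      linear_combination (a0 * b1 - a1 * b0) * h0 - F1 * 2 - (ρ (u 0) * a0 + ρ (u 1) * a1) * F4
        + F3 * (ρ (u 0) * b0 + ρ (u 1) * b1)
    exact h2 (mul_self_eq_zero.mp this)
  let π : PowerSeries k →ₐ[k] k :=
    { (PowerSeries.constantCoeff : PowerSeries k →+* k) with
      commutes' := fun r => by simp [PowerSeries.algebraMap_apply] }
  have hπ : ∀ t, π t = PowerSeries.constantCoeff t := fun _ => rfl
  obtain ⟨φ, hφ⟩ := rdp_lift (P := rdpD k n) (hP := hP) π (by
      intro t ht
      rw [PowerSeries.isUnit_iff_constantCoeff]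
      exact IsUnit.mk0 _ ht) ![PowerSeries.X, 0, 0]
    (by intro i; fin_cases i <;> simp [hπ]) (by simp [hn0])
  have hcomp : π.comp φ = ρ :=
    rdp_hom_ext (by intro i; rw [hρ]; simp [hφ]; fin_cases i <;> simp [hπ])
  apply hdet
  have G : (u 0 * v 1 - u 1 * v 0) * (x ^ 2 + n * x * y ^ (n - 1)) =
      (w 0 * v 1 - w 1 * v 0) * (2 * z) := by
    rw [← E5]
    linear_combination (w 0 * v 1 - w 1 * v 0) * E1 + (w 1 * u 0 - w 0 * u 1) * E3
  have G2 := congrArg φ G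
  rw [← hx, ← hy, ← hz, map_mul, map_mul φ _ (2 * _)] at G2
  simp only [map_add, map_mul, map_pow, hφ] at G2
  have G3 : φ (u 0 * v 1 - u 1 * v 0) = 0 := by
    simpa [hn1, PowerSeries.X_ne_zero] using G2
  rw [← hcomp, AlgHom.comp_apply, G3, map_zero]

end Main

/-- For the rational double point `R` of type `D_l` in odd characteristic `p ≥ 3`,
given by `z² + x²y + x·y^{l-1} = 0` with `l ≥ 4`: the module `Der_k(R)` of `k`-linear
derivations is not free, and no derivation takes a unit value. -/
theorem rdp_D_odd_char_tangent_not_free (k : Type*) [Field k] (p : ℕ) (hp : p.Prime)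
    (hp3 : 3 ≤ p) [CharP k p] (l : ℕ) (hl : 4 ≤ l) :
    let R := rdpLocal k (X 2 ^ 2 + X 0 ^ 2 * X 1 + X 0 * X 1 ^ (l - 1)) (by simp)
    ¬ Module.Free R (Derivation k R R) ∧
      ¬ ∃ (D : Derivation k R R) (f : R), IsUnit (D f) := by
  intro R
  have h2 : (2 : k) ≠ 0 := by
    intro h
    have h' : ((2 : ℕ) : k) = 0 := by exact_mod_cast h
    rw [CharP.cast_eq_zero_iff k p] at h'
    have := Nat.le_of_dvd (by norm_num) h'
    omega
  refine ⟨rdpD_not_free (by omega) h2, ?_⟩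
  rintro ⟨D, f, hf⟩
  obtain ⟨ρ, hρ, hu⟩ := rdp_res (P := rdpD k (l - 1)) (hP := by simp)
  have h0 := rdp_der_zero ρ D (rdpD_mem (by omega) h2 ρ hρ D) f
  exact (hf.map ρ).ne_zero h0
end
end

section
/- Let k be a field of characteristic p ≥ 7 and let P be one of the three polynomials z² + x³ + y⁴, z² + x³ + x·y³, z² + x³ + y⁵ (the rational double points of types E₆, E₇, E₈ in characteristic at least 7). Let R be the localization of k[x,y,z]/(P) at the maximal ideal generated by the images of x, y, z. Then the R-module Der_k(R) of k-linear derivations of R is not free, and there exist no k-linear derivation D of R and element f ∈ R such that D(f) is a unit. -/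
open MvPolynomial

noncomputable section

/-- the relevant abstract interface of the localization of `k[x,y,z]/(P)` at the origin -/
structure RdpLike (k : Type*) [Field k] (P : MvPolynomial (Fin 3) k) (R : Type*) [CommRing R]
    [Algebra k R] (ι : MvPolynomial (Fin 3) k →ₐ[k] R) : Prop where
  surj : ∀ r : R, ∃ α s, constantCoeff s ≠ 0 ∧ r * ι s = ι α
  unit : ∀ s, constantCoeff s ≠ 0 → IsUnit (ι s)
  zero : ∀ α, ι α = 0 → ∃ t, constantCoeff t ≠ 0 ∧ P ∣ t * α
  map_P : ι P = 0

section
variable {k : Type*} [Field k] {P : MvPolynomial (Fin 3) k} {R : Type*} [CommRing R]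
    [Algebra k R] {ι : MvPolynomial (Fin 3) k →ₐ[k] R}

theorem rdpLike_rdpLocal (hP : constantCoeff P = 0) :
    ∃ ι : MvPolynomial (Fin 3) k →ₐ[k] rdpLocal k P hP, RdpLike k P (rdpLocal k P hP) ι := by
  have key : ∀ s : MvPolynomial (Fin 3) k, constantCoeff s ≠ 0 ↔
      Ideal.Quotient.mk (Ideal.span {P}) s ∈ (rdpMaxIdeal k P hP).primeCompl := by
    intro s
    show _ ↔ ¬ (_ ∈ RingHom.ker (rdpEval k P hP))
    rw [RingHom.mem_ker]
    rfl
  let j : (MvPolynomial (Fin 3) k ⧸ Ideal.span {P}) →ₐ[k]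
      Localization (rdpMaxIdeal k P hP).primeCompl :=
    IsScalarTower.toAlgHom k _ _
  let j2 := (j.comp (Ideal.Quotient.mkₐ k (Ideal.span {P})))
  let i : MvPolynomial (Fin 3) k →ₐ[k] rdpLocal k P hP :=
   { toFun := fun α => (j2 α : Localization (rdpMaxIdeal k P hP).primeCompl)
     map_one' := map_one j2
     map_mul' := map_mul j2
     map_zero' := map_zero j2
     map_add' := map_add j2
     commutes' := j2.commutes }
  refine ⟨i, ?_, ?_, ?_, ?_⟩
  · intro r
    obtain ⟨⟨b, s⟩, h⟩ := IsLocalization.surj (rdpMaxIdeal k P hP).primeCompl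
      (S := Localization (rdpMaxIdeal k P hP).primeCompl) r
    obtain ⟨α, rfl⟩ := Ideal.Quotient.mk_surjective b
    obtain ⟨s, hs⟩ := s
    obtain ⟨s, rfl⟩ := Ideal.Quotient.mk_surjective s
    exact ⟨α, s, (key s).2 hs, h⟩
  · intro s hs
    obtain ⟨y, hy⟩ := (IsLocalization.map_units (Localization (rdpMaxIdeal k P hP).primeCompl)
      (⟨_, (key s).1 hs⟩ : (rdpMaxIdeal k P hP).primeCompl)).exists_right_inv
    exact IsUnit.of_mul_eq_one (M := rdpLocal k P hP) y hy
  · intro α h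
    obtain ⟨⟨t, ht⟩, h⟩ := (IsLocalization.map_eq_zero_iff (rdpMaxIdeal k P hP).primeCompl
      (Localization (rdpMaxIdeal k P hP).primeCompl) (Ideal.Quotient.mk (Ideal.span {P}) α)).1 h
    obtain ⟨t, rfl⟩ := Ideal.Quotient.mk_surjective t
    refine ⟨t, (key t).2 ht, ?_⟩
    rw [← Ideal.mem_span_singleton, ← Ideal.Quotient.eq_zero_iff_mem, map_mul]
    exact h
  · have : Ideal.Quotient.mk (Ideal.span {P}) P = 0 :=
      Ideal.Quotient.eq_zero_iff_mem.2 (Ideal.mem_span_singleton_self P)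
    have h2 : j (Ideal.Quotient.mk (Ideal.span {P}) P) = 0 := by rw [this, map_zero]
    exact h2

/-- the universal property -/
theorem RdpLike.lift (H : RdpLike k P R ι) {S : Type*} [CommRing S] [Algebra k S]
    (g : MvPolynomial (Fin 3) k →ₐ[k] S) (hP : g P = 0)
    (hg : ∀ s, constantCoeff s ≠ 0 → IsUnit (g s)) :
    ∃ G : R →ₐ[k] S, ∀ α, G (ι α) = g α := by
  have hz : ∀ α, ι α = 0 → g α = 0 := by
    intro α h
    obtain ⟨t, ht, c, hc⟩ := H.zero α h
    have := congrArg g hc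
    rw [map_mul, map_mul, hP, zero_mul] at this
    exact (hg t ht).mul_right_eq_zero.1 this
  have hz2 : ∀ α β, ι α = ι β → g α = g β := by
    intro α β h
    rw [← sub_eq_zero, ← map_sub]
    exact hz _ (by rw [map_sub, h, sub_self])
  choose num den hden hnum using H.surj
  let F : R → S := fun r => g (num r) * ((hg _ (hden r)).unit⁻¹ : Sˣ)
  have hF : ∀ r α s, constantCoeff s ≠ 0 → r * ι s = ι α → F r * g s = g α := by
    intro r α s hs h
    have h1 : g (num r * s) = g (α * den r) := by
      apply hz2
      rw [map_mul, map_mul, ← hnum, ← h]; ring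
    have h2 : g (den r) * ((hg _ (hden r)).unit⁻¹ : Sˣ) = 1 := (hg _ (hden r)).mul_val_inv
    rw [map_mul, map_mul] at h1
    calc F r * g s = (g (num r) * g s) * ((hg _ (hden r)).unit⁻¹ : Sˣ) := by simp only [F]; ring
      _ = _ := by rw [h1, mul_assoc, h2, mul_one]
  have hFι : ∀ α, F (ι α) = g α := by
    intro α
    simpa using hF (ι α) α 1 (by simp) (by simp)
  have hF2 : ∀ r, F r * g (den r) = g (num r) := fun r => hF _ _ _ (hden r) (hnum r)
  refine ⟨{ toFun := F, map_one' := ?_, map_zero' := ?_, map_mul' := ?_, map_add' := ?_,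
            commutes' := ?_ }, hFι⟩
  · simpa using hFι 1
  · intro a b
    have hu := (hg _ (hden a)).mul (hg _ (hden b))
    apply hu.mul_right_cancel
    have := hF (a * b) (num a * num b) (den a * den b) (by simp [hden]) (by
      rw [map_mul, map_mul, ← hnum a, ← hnum b]; ring)
    rw [map_mul, map_mul] at this
    rw [this, ← hF2 a, ← hF2 b]; ring
  · simpa using hFι 0
  · intro a b
    have hu := (hg _ (hden a)).mul (hg _ (hden b))
    apply hu.mul_right_cancel
    have := hF (a + b) (num a * den b + num b * den a) (den a * den b) (by simp [hden]) (by
      rw [map_mul, map_add, map_mul, map_mul, ← hnum a, ← hnum b]; ring)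
    rw [map_mul, map_add, map_mul, map_mul] at this
    rw [this, ← hF2 a, ← hF2 b]; ring
  · intro c
    have := hFι (C c)
    have h1 : ι (C c) = algebraMap k R c := ι.commutes c
    have h2 : g (C c) = algebraMap k S c := g.commutes c
    rwa [h1, h2] at this

theorem RdpLike.hom_ext (H : RdpLike k P R ι) {S : Type*} [CommRing S] [Algebra k S]
    (F G : R →ₐ[k] S) (h : ∀ α, F (ι α) = G (ι α)) : F = G := by
  ext r
  obtain ⟨α, s, hs, hr⟩ := H.surj r
  apply ((H.unit s hs).map F).mul_right_cancel
  rw [← map_mul, hr, h, h, ← map_mul, hr]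

theorem der_poly (D : Derivation k R R) (α : MvPolynomial (Fin 3) k) :
    D (ι α) = ι (pderiv 0 α) * D (ι (X 0)) + ι (pderiv 1 α) * D (ι (X 1)) +
      ι (pderiv 2 α) * D (ι (X 2)) := by
  induction α using MvPolynomial.induction_on with
  | C a =>
    have h1 : ι (C a) = algebraMap k R a := ι.commutes a
    simp [h1]
  | add p q hp hq => simp only [map_add, hp, hq]; ring
  | mul_X p i hp =>
    rw [map_mul, Derivation.leibniz, hp]
    fin_cases i <;> simp [Derivation.leibniz, pderiv_X, smul_eq_mul] <;> ring

theorem dual_poly (a : Fin 3 → R) (α : MvPolynomial (Fin 3) k) :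
    aeval (fun i => (TrivSqZeroExt.inl (ι (X i)) + TrivSqZeroExt.inr (a i) : DualNumber R)) α
    = TrivSqZeroExt.inl (ι α) + TrivSqZeroExt.inr (ι (pderiv 0 α) * a 0 + ι (pderiv 1 α) * a 1 +
      ι (pderiv 2 α) * a 2) := by
  induction α using MvPolynomial.induction_on with
  | C c =>
    have h1 : ι (C c) = algebraMap k R c := ι.commutes c
    simp [h1, TrivSqZeroExt.algebraMap_eq_inl']
  | add p q hp hq =>
    rw [map_add, hp, hq]
    ext <;> simp
    ring
  | mul_X p i hp =>
    rw [map_mul, hp, aeval_X]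
    ext
    · simp
    · fin_cases i <;> simp [Derivation.leibniz, pderiv_X, smul_eq_mul] <;> ring

theorem RdpLike.exists_der (H : RdpLike k P R ι) (a : Fin 3 → R)
    (ha : ι (pderiv 0 P) * a 0 + ι (pderiv 1 P) * a 1 + ι (pderiv 2 P) * a 2 = 0) :
    ∃ D : Derivation k R R, ∀ i, D (ι (X i)) = a i := by
  obtain ⟨G, hG⟩ := H.lift (aeval (fun i =>
    (TrivSqZeroExt.inl (ι (X i)) + TrivSqZeroExt.inr (a i) : DualNumber R)))
    (by rw [dual_poly, ha, H.map_P]; simp)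
    (by
      intro s hs
      rw [dual_poly, TrivSqZeroExt.isUnit_iff_isUnit_fst]
      simpa using H.unit s hs)
  have h1 : ∀ r, (G r).fst = r := by
    intro r
    have := H.hom_ext ((TrivSqZeroExt.fstHom k R R).comp G) (AlgHom.id k R) (by
      intro α
      simp only [AlgHom.comp_apply, hG, dual_poly]
      simp)
    exact DFunLike.congr_fun this r
  refine ⟨Derivation.mk' (((TrivSqZeroExt.sndHom R R).restrictScalars k) ∘ₗ G.toLinearMap) ?_, ?_⟩
  · intro x y
    simp [h1, mul_comm]
  · intro i
    simp [hG]

/-- residue map together with a linear coefficient -/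
theorem RdpLike.exists_coeff (H : RdpLike k P R ι) (h0 : constantCoeff P = 0)
    (h1 : ∀ i, constantCoeff (pderiv i P) = 0) (c : Fin 3 → k) :
    ∃ G : R →ₐ[k] DualNumber k, ∀ α, G (ι α) =
      TrivSqZeroExt.inl (constantCoeff α) + TrivSqZeroExt.inr (constantCoeff (pderiv 0 α) * c 0 +
        constantCoeff (pderiv 1 α) * c 1 + constantCoeff (pderiv 2 α) * c 2) := by
  let e : MvPolynomial (Fin 3) k →ₐ[k] k := aeval 0
  have he : ∀ α, e α = constantCoeff α := fun α => by simp [e]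
  have := dual_poly (ι := e) c
  simp only [he] at this
  obtain ⟨G, hG⟩ := H.lift _ (by rw [this, h0, h1, h1, h1]; simp) (by
      intro s hs
      rw [this, TrivSqZeroExt.isUnit_iff_isUnit_fst]
      simpa using hs)
  exact ⟨G, fun α => (hG α).trans (this α)⟩

theorem abstract_main (H : RdpLike k P R ι) (h0 : constantCoeff P = 0)
    (h1 : ∀ i, constantCoeff (pderiv i P) = 0)
    (hC : ∀ a b c d, a * pderiv 0 P + b * pderiv 1 P + c * pderiv 2 P = P * d →
      constantCoeff a = 0 ∧ constantCoeff b = 0 ∧ constantCoeff c = 0)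
    (h2 : (2 : k) ≠ 0) (hz : pderiv 2 P = C 2 * X 2) (hzP : ¬ X 2 ∣ P)
    (w : Fin 3 → k) (w' : k) (hw : w 0 ≠ 0)
    (hE : C (w 0) * X 0 * pderiv 0 P + C (w 1) * X 1 * pderiv 1 P + C (w 2) * X 2 * pderiv 2 P
      = C w' * P) :
    ¬ Module.Free R (Derivation k R R) ∧
      ¬ ∃ (D : Derivation k R R) (f : R), IsUnit (D f) := by
  choose G hG using H.exists_coeff h0 h1
  let ρ : R →ₐ[k] k := (TrivSqZeroExt.fstHom k k k).comp (G 0)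
  have hρ : ∀ α, ρ (ι α) = constantCoeff α := by
    intro α; simp [ρ, hG]
  have hGρ : ∀ c r, (G c r).fst = ρ r := by
    intro c r
    have := H.hom_ext ((TrivSqZeroExt.fstHom k k k).comp (G c)) ρ (by
      intro α
      rw [hρ]
      simp [hG])
    exact DFunLike.congr_fun this r
  -- values of derivations on the coordinates
  have hX : ∀ (D : Derivation k R R), ρ (D (ι (X 0))) = 0 ∧ ρ (D (ι (X 1))) = 0 ∧
      ρ (D (ι (X 2))) = 0 := by
    intro D
    have hD := der_poly (ι := ι) D P
    rw [H.map_P, map_zero] at hD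
    obtain ⟨a, s, hs, ha⟩ := H.surj (D (ι (X 0)))
    obtain ⟨b, t, ht, hb⟩ := H.surj (D (ι (X 1)))
    obtain ⟨c, u, hu, hc⟩ := H.surj (D (ι (X 2)))
    obtain ⟨v, hv, d, hd⟩ := H.zero ((a * t * u) * pderiv 0 P + (b * s * u) * pderiv 1 P +
      (c * s * t) * pderiv 2 P) (by
        simp only [map_add, map_mul, ← ha, ← hb, ← hc]
        linear_combination (- ι s * ι t * ι u) * hD)
    obtain ⟨A, B, C'⟩ := hC (v * (a * t * u)) (v * (b * s * u)) (v * (c * s * t)) d (by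
      rw [← hd]; ring)
    simp [hs, ht, hu, hv] at A B C'
    have ha' := congrArg ρ ha
    have hb' := congrArg ρ hb
    have hc' := congrArg ρ hc
    simp only [map_mul, hρ, A, B, C'] at ha' hb' hc'
    simp [hs, ht, hu] at ha' hb' hc'
    exact ⟨ha', hb', hc'⟩
  have hD0 : ∀ (D : Derivation k R R) (f : R), ρ (D f) = 0 := by
    intro D f
    have hp : ∀ α, ρ (D (ι α)) = 0 := by
      intro α
      obtain ⟨x, y, z⟩ := hX D
      rw [der_poly]
      simp [x, y, z]
    obtain ⟨α, s, hs, h⟩ := H.surj f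
    have := hp α
    rw [← h, Derivation.leibniz, map_add, smul_eq_mul, smul_eq_mul, map_mul, map_mul, hp, hρ] at this
    simpa [hs] using this
  have : Nontrivial R := ρ.toRingHom.domain_nontrivial
  refine ⟨?_, ?_⟩
  swap
  · rintro ⟨D, f, h⟩
    have := h.map ρ
    rw [hD0] at this
    exact not_isUnit_zero this
  intro hfree
  -- rank at most two
  have hznz : ∀ r, ι (X 2) * r = 0 → r = 0 := by
    intro r hr
    obtain ⟨α, s, hs, h⟩ := H.surj r
    obtain ⟨t, ht, c, hc⟩ := H.zero (X 2 * α) (by rw [map_mul, ← h, ← mul_assoc, hr, zero_mul])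
    have hprime : Prime (X 2 : MvPolynomial (Fin 3) k) := MvPolynomial.X_prime
    have : X 2 ∣ P * c := ⟨t * α, by rw [← hc]; ring⟩
    obtain ⟨c', rfl⟩ := (hprime.dvd_or_dvd this).resolve_left hzP
    have h3 : t * α = P * c' := by
      apply mul_left_cancel₀ hprime.ne_zero
      linear_combination hc
    have h4 := congrArg ι h3
    rw [map_mul, map_mul, H.map_P, zero_mul, ← h] at h4
    have h5 := (H.unit t ht).mul_right_eq_zero.1 h4
    exact (H.unit s hs).mul_left_eq_zero.1 h5
  have h2R : IsUnit (ι (C 2)) := H.unit _ (by simpa using h2)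
  have hinj0 : ∀ D : Derivation k R R, D (ι (X 0)) = 0 → D (ι (X 1)) = 0 → D = 0 := by
    intro D hx hy
    have hD := der_poly (ι := ι) D P
    rw [H.map_P, map_zero, hx, hy, hz, map_mul] at hD
    have hz' : D (ι (X 2)) = 0 := by
      apply hznz
      apply h2R.mul_right_eq_zero.1
      linear_combination - hD
    have hp : ∀ α, D (ι α) = 0 := by
      intro α
      rw [der_poly, hx, hy, hz']; simp
    ext f
    obtain ⟨α, s, hs, h⟩ := H.surj f
    have := hp α
    rw [← h, Derivation.leibniz, hp, smul_zero, zero_add, smul_eq_mul] at this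
    simpa using (H.unit s hs).mul_right_eq_zero.1 this
  let T : Derivation k R R →ₗ[R] (Fin 2 → R) :=
    { toFun := fun D => ![D (ι (X 0)), D (ι (X 1))]
      map_add' := by intro D D'; ext i; fin_cases i <;> simp
      map_smul' := by intro r D; ext i; fin_cases i <;> simp }
  have hT : Function.Injective T := by
    rw [injective_iff_map_eq_zero]
    intro D hD
    exact hinj0 D (by simpa [T] using congrFun hD 0) (by simpa [T] using congrFun hD 1)
  have hrank : Module.rank R (Derivation k R R) ≤ 2 := by
    have := LinearMap.rank_le_of_injective T hT
    simpa using this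
  let b := Module.Free.chooseBasis R (Derivation k R R)
  have hcard := b.mk_eq_rank''

  obtain ⟨E, hEv⟩ := H.exists_der (fun i => ι (C (w i) * X i)) (by
    have := congrArg ι hE
    rw [map_mul ι (C w'), H.map_P, mul_zero] at this
    rw [← this]
    simp only [map_add, map_mul]; ring)
  obtain ⟨Hx, hHx⟩ := H.exists_der ![0, - ι (pderiv 2 P), ι (pderiv 1 P)] (by simp; ring)
  obtain ⟨Hy, hHy⟩ := H.exists_der ![ι (pderiv 2 P), 0, - ι (pderiv 0 P)] (by simp; ring)
  let L : Derivation k R R → (Fin 3 → k) := fun D =>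
    ![(G ![1, 0, 0] (D (ι (X 0)))).snd, (G ![0, 0, 1] (D (ι (X 0)))).snd,
      (G ![0, 0, 1] (D (ι (X 1)))).snd]
  have Ladd : ∀ D D', L (D + D') = L D + L D' := by
    intro D D'; ext i; fin_cases i <;> simp [L]
  have Lzero : L 0 = 0 := by ext i; fin_cases i <;> simp [L]
  have Lsmul : ∀ (r : R) D, L (r • D) = ρ r • L D := by
    intro r D; ext i; fin_cases i <;> simp [L, hGρ, hD0]
  have hspan : ∀ D, L D ∈ Submodule.span k (Set.range (fun i => L (b i))) := by
    intro D
    induction b.mem_span D using Submodule.span_induction with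
    | mem x hx =>
      obtain ⟨i, rfl⟩ := hx
      exact Submodule.subset_span ⟨i, rfl⟩
    | zero => rw [Lzero]; exact Submodule.zero_mem _
    | add x y _ _ hx hy => rw [Ladd]; exact Submodule.add_mem _ hx hy
    | smul r x _ hx => rw [Lsmul]; exact Submodule.smul_mem _ _ hx
  have LE : L E = ![w 0, 0, 0] := by
    ext i; fin_cases i <;> simp [L, hEv, hG, -map_mul, Derivation.leibniz, pderiv_X]
  have LHx : L Hx = ![0, 0, -2] := by
    ext i; fin_cases i <;> simp [L, hHx, hG, hz, -map_mul, Derivation.leibniz, pderiv_X]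
  have LHy : L Hy = ![0, 2, 0] := by
    ext i; fin_cases i <;> simp [L, hHy, hG, hz, -map_mul, Derivation.leibniz, pderiv_X]
  have htop : Submodule.span k (Set.range (fun i => L (b i))) = ⊤ := by
    rw [eq_top_iff]
    intro v _
    have : v = (v 0 / w 0) • L E + (v 1 / 2) • L Hy + (- v 2 / 2) • L Hx := by
      rw [LE, LHx, LHy]
      ext i; fin_cases i <;> simp [hw, h2]
    rw [this]
    exact Submodule.add_mem _ (Submodule.add_mem _ (Submodule.smul_mem _ _ (hspan _))
      (Submodule.smul_mem _ _ (hspan _))) (Submodule.smul_mem _ _ (hspan _))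
  rw [← hcard] at hrank
  have hfin : Finite (Module.Free.ChooseBasisIndex R (Derivation k R R)) := by
    rw [← Cardinal.mk_lt_aleph0_iff]
    exact hrank.trans_lt (by exact_mod_cast Cardinal.natCast_lt_aleph0 (n := 2))
  have := Fintype.ofFinite (Module.Free.ChooseBasisIndex R (Derivation k R R))
  have hle := finrank_range_le_card (R := k) (fun i => L (b i))
  rw [Set.finrank, htop, finrank_top] at hle
  rw [Cardinal.mk_fintype] at hrank
  have : Fintype.card (Module.Free.ChooseBasisIndex R (Derivation k R R)) ≤ 2 := by
    exact_mod_cast hrank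
  simp at hle
  omega

theorem C_num :
    (C 2 : MvPolynomial (Fin 3) k) = 2 ∧
    (C 3 : MvPolynomial (Fin 3) k) = 3 ∧
    (C 4 : MvPolynomial (Fin 3) k) = 4 ∧
    (C 5 : MvPolynomial (Fin 3) k) = 5 ∧
    (C 6 : MvPolynomial (Fin 3) k) = 6 ∧
    (C 9 : MvPolynomial (Fin 3) k) = 9 ∧
    (C 10 : MvPolynomial (Fin 3) k) = 10 ∧
    (C 12 : MvPolynomial (Fin 3) k) = 12 ∧
    (C 15 : MvPolynomial (Fin 3) k) = 15 ∧
    (C 18 : MvPolynomial (Fin 3) k) = 18 ∧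
    (C 30 : MvPolynomial (Fin 3) k) = 30 :=
  ⟨map_ofNat C 2, map_ofNat C 3, map_ofNat C 4, map_ofNat C 5, map_ofNat C 6, map_ofNat C 9, map_ofNat C 10, map_ofNat C 12, map_ofNat C 15, map_ofNat C 18, map_ofNat C 30⟩

theorem coeff_X_pow_mul_aux (e : Fin 3 →₀ ℕ) (i : Fin 3) (n : ℕ) (f : MvPolynomial (Fin 3) k) :
    coeff e (f * X i ^ n) = if n ≤ e i then coeff (e - Finsupp.single i n) f else 0 := by
  rw [X_pow_eq_monomial, coeff_mul_monomial']
  simp only [Finsupp.single_le_iff, mul_one]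

/-- coefficient of `x^a y^b z^c` -/
def cf (a b c : ℕ) (f : MvPolynomial (Fin 3) k) : k :=
  coeff (Finsupp.single 0 a + Finsupp.single 1 b + Finsupp.single 2 c) f

theorem cf_add (a b c : ℕ) (f g : MvPolynomial (Fin 3) k) :
    cf a b c (f + g) = cf a b c f + cf a b c g := coeff_add _ _ _

theorem cf_C (a b c : ℕ) (f : MvPolynomial (Fin 3) k) (r : k) :
    cf a b c (f * C r) = cf a b c f * r := by
  rw [cf, cf, mul_comm f, coeff_C_mul, mul_comm]

theorem cf_zero (f : MvPolynomial (Fin 3) k) : cf 0 0 0 f = constantCoeff f := by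
  simp [cf, constantCoeff_eq]

theorem cf_x (a b c n : ℕ) (f : MvPolynomial (Fin 3) k) :
    cf a b c (f * X 0 ^ n) = if n ≤ a then cf (a - n) b c f else 0 := by
  rw [cf, coeff_X_pow_mul_aux]
  simp only [cf]
  congr 1
  · simp
  · congr 1
    ext i; fin_cases i <;> simp

theorem cf_y (a b c n : ℕ) (f : MvPolynomial (Fin 3) k) :
    cf a b c (f * X 1 ^ n) = if n ≤ b then cf a (b - n) c f else 0 := by
  rw [cf, coeff_X_pow_mul_aux]
  simp only [cf]
  congr 1
  · simp
  · congr 1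
    ext i; fin_cases i <;> simp

theorem cf_z (a b c n : ℕ) (f : MvPolynomial (Fin 3) k) :
    cf a b c (f * X 2 ^ n) = if n ≤ c then cf a b (c - n) f else 0 := by
  rw [cf, coeff_X_pow_mul_aux]
  simp only [cf]
  congr 1
  · simp
  · congr 1
    ext i; fin_cases i <;> simp

theorem not_z_dvd (Q : MvPolynomial (Fin 3) k) (a b : ℕ) (h : cf a b 0 Q ≠ 0) : ¬ X 2 ∣ Q := by
  rintro ⟨c, rfl⟩
  apply h
  rw [mul_comm, ← pow_one (X 2), cf_z]
  simp

theorem case_E6 (h2 : (2 : k) ≠ 0) (h3 : (3 : k) ≠ 0)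
    (hP : P = X 2 ^ 2 + X 0 ^ 3 + X 1 ^ 4) (H : RdpLike k P R ι) :
    ¬ Module.Free R (Derivation k R R) ∧
      ¬ ∃ (D : Derivation k R R) (f : R), IsUnit (D f) := by
  have p0 : pderiv 0 P = C 3 * X 0 ^ 2 := by
    simp [hP, pderiv_X, Derivation.leibniz_pow, C_num]
  have p1 : pderiv 1 P = C 4 * X 1 ^ 3 := by
    simp [hP, pderiv_X, Derivation.leibniz_pow, C_num]
  have p2 : pderiv 2 P = C 2 * X 2 := by
    simp [hP, pderiv_X, Derivation.leibniz_pow, C_num]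
  have h4 : (4 : k) ≠ 0 := by
    have : (4 : k) = 2 * 2 := by norm_num
    rw [this]; exact mul_ne_zero h2 h2
  refine abstract_main H (by simp [hP]) ?_ ?_ h2 p2 ?_ ![4, 3, 6] 12 (by simpa using h4) ?_
  · intro i; fin_cases i <;> simp [p0, p1, p2]
  · intro a b c d h
    replace h : a * C 3 * X 0 ^ 2 + b * C 4 * X 1 ^ 3 + c * C 2 * X 2 ^ 1 =
        d * X 2 ^ 2 + d * X 0 ^ 3 + d * X 1 ^ 4 := by
      rw [p0, p1, p2, hP] at h
      linear_combination h
    have e0 := congrArg (cf 2 0 0) h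
    have e1 := congrArg (cf 0 3 0) h
    have e2 := congrArg (cf 0 0 1) h
    simp only [cf_add, cf_x, cf_y, cf_z] at e0 e1 e2
    simp [cf_C, cf_zero, h2, h3, h4] at e0 e1 e2
    exact ⟨e0, e1, e2⟩
  · apply not_z_dvd _ 3 0
    rw [hP, ← one_mul (X 2 ^ 2), ← one_mul (X 0 ^ 3), ← one_mul (X 1 ^ 4)]
    simp only [cf_add, cf_x, cf_y, cf_z]
    simp [cf_zero]
  · rw [p0, p1, p2, hP]
    simp [C_num]
    ring

theorem case_E7 (h2 : (2 : k) ≠ 0) (h3 : (3 : k) ≠ 0)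
    (hP : P = X 2 ^ 2 + X 0 ^ 3 + X 0 * X 1 ^ 3) (H : RdpLike k P R ι) :
    ¬ Module.Free R (Derivation k R R) ∧
      ¬ ∃ (D : Derivation k R R) (f : R), IsUnit (D f) := by
  have p0 : pderiv 0 P = C 3 * X 0 ^ 2 + X 1 ^ 3 := by
    simp [hP, pderiv_X, Derivation.leibniz, Derivation.leibniz_pow, C_num]
  have p1 : pderiv 1 P = C 3 * X 0 * X 1 ^ 2 := by
    simp [hP, pderiv_X, Derivation.leibniz, Derivation.leibniz_pow, C_num]
    ring
  have p2 : pderiv 2 P = C 2 * X 2 := by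
    simp [hP, pderiv_X, Derivation.leibniz, Derivation.leibniz_pow, C_num]
  have h6 : (6 : k) ≠ 0 := by
    have : (6 : k) = 2 * 3 := by norm_num
    rw [this]; exact mul_ne_zero h2 h3
  refine abstract_main H (by simp [hP]) ?_ ?_ h2 p2 ?_ ![6, 4, 9] 18 (by simpa using h6) ?_
  · intro i; fin_cases i <;> simp [p0, p1, p2]
  · intro a b c d h
    replace h : a * C 3 * X 0 ^ 2 + a * X 1 ^ 3 + b * C 3 * X 0 ^ 1 * X 1 ^ 2 + c * C 2 * X 2 ^ 1 =
        d * X 2 ^ 2 + d * X 0 ^ 3 + d * X 0 ^ 1 * X 1 ^ 3 := by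
      rw [p0, p1, p2, hP] at h
      linear_combination h
    have e0 := congrArg (cf 2 0 0) h
    have e1 := congrArg (cf 1 2 0) h
    have e2 := congrArg (cf 0 0 1) h
    simp only [cf_add, cf_x, cf_y, cf_z] at e0 e1 e2
    simp [cf_C, cf_zero, h2, h3] at e0 e1 e2
    exact ⟨e0, e1, e2⟩
  · apply not_z_dvd _ 3 0
    rw [hP, ← one_mul (X 2 ^ 2), ← one_mul (X 0 ^ 3)]
    simp only [cf_add, cf_x, cf_y, cf_z]
    simp [cf_zero]
  · rw [p0, p1, p2, hP]
    simp [C_num]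
    ring

theorem case_E8 (h2 : (2 : k) ≠ 0) (h3 : (3 : k) ≠ 0) (h5 : (5 : k) ≠ 0)
    (hP : P = X 2 ^ 2 + X 0 ^ 3 + X 1 ^ 5) (H : RdpLike k P R ι) :
    ¬ Module.Free R (Derivation k R R) ∧
      ¬ ∃ (D : Derivation k R R) (f : R), IsUnit (D f) := by
  have p0 : pderiv 0 P = C 3 * X 0 ^ 2 := by
    simp [hP, pderiv_X, Derivation.leibniz_pow, C_num]
  have p1 : pderiv 1 P = C 5 * X 1 ^ 4 := by
    simp [hP, pderiv_X, Derivation.leibniz_pow, C_num]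
  have p2 : pderiv 2 P = C 2 * X 2 := by
    simp [hP, pderiv_X, Derivation.leibniz_pow, C_num]
  have h10 : (10 : k) ≠ 0 := by
    have : (10 : k) = 2 * 5 := by norm_num
    rw [this]; exact mul_ne_zero h2 h5
  refine abstract_main H (by simp [hP]) ?_ ?_ h2 p2 ?_ ![10, 6, 15] 30 (by simpa using h10) ?_
  · intro i; fin_cases i <;> simp [p0, p1, p2]
  · intro a b c d h
    replace h : a * C 3 * X 0 ^ 2 + b * C 5 * X 1 ^ 4 + c * C 2 * X 2 ^ 1 =
        d * X 2 ^ 2 + d * X 0 ^ 3 + d * X 1 ^ 5 := by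
      rw [p0, p1, p2, hP] at h
      linear_combination h
    have e0 := congrArg (cf 2 0 0) h
    have e1 := congrArg (cf 0 4 0) h
    have e2 := congrArg (cf 0 0 1) h
    simp only [cf_add, cf_x, cf_y, cf_z] at e0 e1 e2
    simp [cf_C, cf_zero, h2, h3, h5] at e0 e1 e2
    exact ⟨e0, e1, e2⟩
  · apply not_z_dvd _ 3 0
    rw [hP, ← one_mul (X 2 ^ 2), ← one_mul (X 0 ^ 3), ← one_mul (X 1 ^ 5)]
    simp only [cf_add, cf_x, cf_y, cf_z]
    simp [cf_zero]
  · rw [p0, p1, p2, hP]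
    simp [C_num]
    ring

end

/-- For the rational double points `R` of types `E₆, E₇, E₈` in characteristic `p ≥ 7`,
given by `z² + x³ + y⁴ = 0`, `z² + x³ + x·y³ = 0`, `z² + x³ + y⁵ = 0` respectively:
the module `Der_k(R)` of `k`-linear derivations is not free, and no derivation takes a
unit value. -/
theorem rdp_E_large_char_tangent_not_free (k : Type*) [Field k] (p : ℕ) (hp : p.Prime)
    (hp7 : 7 ≤ p) [CharP k p] (P : MvPolynomial (Fin 3) k)
    (hP3 : P = X 2 ^ 2 + X 0 ^ 3 + X 1 ^ 4 ∨ P = X 2 ^ 2 + X 0 ^ 3 + X 0 * X 1 ^ 3 ∨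
      P = X 2 ^ 2 + X 0 ^ 3 + X 1 ^ 5) :
    let R := rdpLocal k P (by rcases hP3 with rfl | rfl | rfl <;> simp)
    ¬ Module.Free R (Derivation k R R) ∧
      ¬ ∃ (D : Derivation k R R) (f : R), IsUnit (D f) := by
  intro R
  have hn : ∀ n : ℕ, 0 < n → n < 7 → (n : k) ≠ 0 := by
    intro n h0 h7 h
    have := Nat.le_of_dvd h0 ((CharP.cast_eq_zero_iff k p n).1 h)
    omega
  have h2 : (2 : k) ≠ 0 := by exact_mod_cast hn 2 (by norm_num) (by norm_num)
  have h3 : (3 : k) ≠ 0 := by exact_mod_cast hn 3 (by norm_num) (by norm_num)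
  have h5 : (5 : k) ≠ 0 := by exact_mod_cast hn 5 (by norm_num) (by norm_num)
  have hP0 : constantCoeff P = 0 := by rcases hP3 with rfl | rfl | rfl <;> simp
  obtain ⟨ι, H⟩ := rdpLike_rdpLocal hP0
  rcases hP3 with h | h | h
  · exact case_E6 h2 h3 h H
  · exact case_E7 h2 h3 h H
  · exact case_E8 h2 h3 h5 h H
end
end

section
/- Let k be a field of characteristic 2, let n ≥ 2 be an integer, and let P be either z² + x²·y + x·y^n (type D_{2n}⁰) or z² + x²·y + y^n·z (type D_{2n+1}⁰). Let R be the localization of k[x,y,z]/(P) at the maximal ideal generated by the images of x, y, z. Then the R-module Der_k(R) of k-linear derivations of R is free, and there exist a k-linear derivation D of R and an element f ∈ R such that D(f) is a unit. -/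
open MvPolynomial

noncomputable section

theorem rdpAux_free {k R : Type*} [Field k] [CommRing R] [Nontrivial R] [Algebra k R]
    (u v w y q : R) (n : ℕ)
    (hext : ∀ D D' : Derivation k R R, D u = D' u → D v = D' v → D w = D' w → D = D')
    (hex : ∀ a b c : R, y ^ n * a + q * b = 0 →
      ∃ D : Derivation k R R, D u = a ∧ D v = b ∧ D w = c)
    (hrel : ∀ D : Derivation k R R, y ^ n * D u + q * D v = 0)
    (hy : ∀ t : R, y * t = 0 → t = 0)
    (hyq : ∀ t : R, y ∣ q * t → y ∣ t) :
    Module.Free R (Derivation k R R) ∧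
      ∃ (D : Derivation k R R) (f : R), IsUnit (D f) := by
  have hy1 : ∀ m : ℕ, ∀ t : R, y ^ m * t = 0 → t = 0 := by
    intro m
    induction m with
    | zero => intro t ht; simpa using ht
    | succ m ih =>
      intro t ht
      apply hy
      apply ih
      rw [← ht]; ring
  have hy2 : ∀ m : ℕ, ∀ t : R, y ^ m ∣ q * t → y ^ m ∣ t := by
    intro m
    induction m with
    | zero => intro t _; simp
    | succ m ih =>
      intro t ht
      obtain ⟨s, rfl⟩ := ih t ((pow_dvd_pow y (Nat.le_succ m)).trans ht)
      obtain ⟨r, hr⟩ := ht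
      have h3 : y ∣ q * s := by
        refine ⟨r, ?_⟩
        have := hy1 m (q * s - y * r) (by linear_combination hr)
        linear_combination this
      obtain ⟨e, rfl⟩ := hyq s h3
      exact ⟨e, by ring⟩
  obtain ⟨D1, h1u, h1v, h1w⟩ := hex 0 0 1 (by ring)
  obtain ⟨D2, h2u, h2v, h2w⟩ := hex q (- y ^ n) 0 (by ring)
  refine ⟨?_, D1, w, by rw [h1w]; exact isUnit_one⟩
  let φ : (R × R) →ₗ[R] Derivation k R R :=
    (LinearMap.toSpanSingleton R _ D1).coprod (LinearMap.toSpanSingleton R _ D2)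
  have hφ : ∀ s t, φ (s, t) = s • D1 + t • D2 := by
    intro s t; simp [φ]
  have hb : Function.Bijective φ := by
    constructor
    · rw [injective_iff_map_eq_zero]
      rintro ⟨s, t⟩ h
      rw [hφ] at h
      have hw := congrArg (fun D : Derivation k R R => D w) h
      have hv := congrArg (fun D : Derivation k R R => D v) h
      simp [h1w, h2w, h1v, h2v] at hw hv
      have ht : t = 0 := hy1 n t (by rw [mul_comm]; exact hv)
      simp [hw, ht]
    · intro D
      have h := hrel D
      obtain ⟨t, ht⟩ := hy2 n (D v) ⟨- D u, by linear_combination h⟩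
      refine ⟨(D w, -t), ?_⟩
      rw [hφ]
      rw [ht] at h
      have h' := hy1 n (D u + q * t) (by linear_combination h)
      apply hext
      · simp [h1u, h2u]; linear_combination - h'
      · simp [h1v, h2v, ht]; ring
      · simp [h1w, h2w]
  exact Module.Free.of_equiv (LinearEquiv.ofBijective φ hb)

theorem rdpAux_mem {k : Type*} [Field k] (P : MvPolynomial (Fin 3) k)
    (e : MvPolynomial (Fin 3) k) (hP : P = X 2 ^ 2 + X 1 * e) :
    (∀ t : MvPolynomial (Fin 3) k, P ∣ X 1 * t → P ∣ t) ∧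
    (∀ b c d : MvPolynomial (Fin 3) k, X 0 ^ 2 * b = X 1 * c + P * d →
      ∃ c' d', b = X 1 * c' + P * d') := by
  have hX : ∀ i : Fin 3, Prime (X i : MvPolynomial (Fin 3) k) := fun i => X_prime
  let σ : MvPolynomial (Fin 3) k →ₐ[k] MvPolynomial (Fin 3) k := aeval ![X 0, 0, X 2]
  have hσ : ∀ b, (X 1 : MvPolynomial (Fin 3) k) ∣ b - σ b := by
    intro b
    rw [← Ideal.mem_span_singleton, ← Ideal.Quotient.eq]
    have : Ideal.Quotient.mkₐ k (Ideal.span {(X 1 : MvPolynomial (Fin 3) k)}) =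
        (Ideal.Quotient.mkₐ k (Ideal.span {(X 1 : MvPolynomial (Fin 3) k)})).comp σ := by
      apply MvPolynomial.algHom_ext
      intro i
      fin_cases i
      · simp [σ]
      · simp [σ]
      · simp [σ]
    exact DFunLike.congr_fun this b
  have σ0 : σ (X 0) = X 0 := by simp [σ]
  have σ1 : σ (X 1) = 0 := by simp [σ]
  have σ2 : σ (X 2) = X 2 := by simp [σ]
  constructor
  · rintro t ⟨c, hc⟩
    have h1 : (X 1 : MvPolynomial (Fin 3) k) ∣ P * c := ⟨t, hc.symm⟩
    rcases (hX 1).dvd_or_dvd h1 with ⟨r, hr⟩ | ⟨r, rfl⟩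
    · exfalso
      have := congrArg σ hr
      rw [hP] at this
      simp [σ1, σ2] at this
    · refine ⟨r, ?_⟩
      apply mul_left_cancel₀ (hX 1).ne_zero
      rw [hc]; ring
  · intro b c d h
    have h0 : X 0 ^ 2 * σ b = X 2 ^ 2 * σ d := by
      have := congrArg σ h
      rw [hP] at this
      simpa [σ0, σ1, σ2] using this
    have h2 : (X 2 : MvPolynomial (Fin 3) k) ^ 2 ∣ σ b := by
      apply (hX 2).pow_dvd_of_dvd_mul_left 2 (a := X 0 ^ 2) _ ⟨σ d, h0⟩
      intro hd
      have := (hX 2).dvd_of_dvd_pow hd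
      rw [X_dvd_X] at this
      simp at this
    obtain ⟨d', hd'⟩ := h2
    obtain ⟨c', hc'⟩ := hσ b
    refine ⟨c' - e * d', d', ?_⟩
    rw [hP]
    linear_combination hc' + hd'

section
variable {k : Type*} [Field k] {P : MvPolynomial (Fin 3) k}
  {R : Type*} [CommRing R] [Algebra k R] [Algebra (MvPolynomial (Fin 3) k ⧸ Ideal.span {P}) R]
  [IsScalarTower k (MvPolynomial (Fin 3) k ⧸ Ideal.span {P}) R]

/-- The structure map from the polynomial ring. -/
def rdpAuxG (k : Type*) [Field k] (P : MvPolynomial (Fin 3) k)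
  (R : Type*) [CommRing R] [Algebra k R] [Algebra (MvPolynomial (Fin 3) k ⧸ Ideal.span {P}) R]
  [IsScalarTower k (MvPolynomial (Fin 3) k ⧸ Ideal.span {P}) R] :
    MvPolynomial (Fin 3) k →ₐ[k] R :=
  (IsScalarTower.toAlgHom k (MvPolynomial (Fin 3) k ⧸ Ideal.span {P}) R).comp
    (Ideal.Quotient.mkₐ k (Ideal.span {P}))

theorem rdpAuxG_P : rdpAuxG k P R P = 0 := by
  have : Ideal.Quotient.mk (Ideal.span {P}) P = 0 :=
    Ideal.Quotient.eq_zero_iff_mem.2 (Ideal.mem_span_singleton_self P)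
  simp [rdpAuxG, this]


theorem rdpAux_ext (M : Submonoid (MvPolynomial (Fin 3) k ⧸ Ideal.span {P})) [IsLocalization M R]
    (D D' : Derivation k R R)
    (h : ∀ i, D (rdpAuxG k P R (X i)) = D' (rdpAuxG k P R (X i))) : D = D' := by
  have h1 : ∀ p, D (rdpAuxG k P R p) = D' (rdpAuxG k P R p) := by
    intro p
    induction p using MvPolynomial.induction_on with
    | C a =>
      have : rdpAuxG k P R (C a) = algebraMap k R a := (rdpAuxG k P R).commutes a
      rw [this]; simp
    | add p q hp hq => simp [hp, hq]
    | mul_X p i hp => simp [hp, h i]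
  ext r
  obtain ⟨s, m, rfl⟩ := IsLocalization.exists_mk'_eq M r
  obtain ⟨p, rfl⟩ := Ideal.Quotient.mk_surjective s
  obtain ⟨m, hm⟩ := m
  obtain ⟨l, rfl⟩ := Ideal.Quotient.mk_surjective m
  have hu := IsLocalization.map_units R (⟨_, hm⟩ : M)
  have e := IsLocalization.mk'_spec R (Ideal.Quotient.mk (Ideal.span {P}) p) ⟨_, hm⟩
  set t := IsLocalization.mk' R (Ideal.Quotient.mk (Ideal.span {P}) p) ⟨_, hm⟩
  change t * rdpAuxG k P R l = rdpAuxG k P R p at e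
  change IsUnit (rdpAuxG k P R l) at hu
  have e1 := congrArg D e
  have e2 := congrArg D' e
  simp only [Derivation.leibniz, smul_eq_mul] at e1 e2
  rw [h1] at e1
  rw [h1] at e1
  apply hu.mul_left_cancel
  linear_combination e1 - e2


theorem rdpAux_exists (M : Submonoid (MvPolynomial (Fin 3) k ⧸ Ideal.span {P})) [IsLocalization M R]
    (a : Fin 3 → R)
    (h : (aeval (fun i => TrivSqZeroExt.inl (rdpAuxG k P R (X i)) + TrivSqZeroExt.inr (a i)) P :
      TrivSqZeroExt R R) = 0) :
    ∃ D : Derivation k R R, ∀ i, D (rdpAuxG k P R (X i)) = a i := by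
  let f : MvPolynomial (Fin 3) k →ₐ[k] TrivSqZeroExt R R :=
    aeval (fun i => TrivSqZeroExt.inl (rdpAuxG k P R (X i)) + TrivSqZeroExt.inr (a i))
  have hf : (TrivSqZeroExt.fstHom k R R).comp f = rdpAuxG k P R := by
    apply MvPolynomial.algHom_ext
    intro i
    simp [f]
  have hf0 : ∀ p ∈ Ideal.span {P}, f p = 0 := by
    intro p hp
    obtain ⟨c, rfl⟩ := Ideal.mem_span_singleton.1 hp
    rw [map_mul, show f P = 0 from h, zero_mul]
  let f' := Ideal.Quotient.liftₐ (Ideal.span {P}) f hf0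
  have hf' : ∀ p, f' (Ideal.Quotient.mk _ p) = f p := fun p => rfl
  have hu : ∀ m : M, IsUnit (f' m) := by
    rintro ⟨m, hm⟩
    obtain ⟨l, rfl⟩ := Ideal.Quotient.mk_surjective m
    rw [TrivSqZeroExt.isUnit_iff_isUnit_fst, hf']
    have := IsLocalization.map_units R (⟨_, hm⟩ : M)
    change IsUnit (rdpAuxG k P R l) at this
    rw [← hf] at this
    exact this
  let F : R →ₐ[k] TrivSqZeroExt R R := IsLocalization.liftAlgHom (M := M) (f := f') hu
  have hF : ∀ p, F (rdpAuxG k P R p) = f p := by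
    intro p
    change IsLocalization.lift (M := M) _ (algebraMap _ R (Ideal.Quotient.mk (Ideal.span {P}) p)) = _
    rw [IsLocalization.lift_eq]
    rfl
  have hfst : ∀ r, (F r).fst = r := by
    have : ((TrivSqZeroExt.fstHom k R R).comp F : R →+* R) = RingHom.id R := by
      apply IsLocalization.ringHom_ext M
      refine RingHom.ext fun s => ?_
      obtain ⟨p, rfl⟩ := Ideal.Quotient.mk_surjective s
      change (F (rdpAuxG k P R p)).fst = rdpAuxG k P R p
      rw [hF]
      exact DFunLike.congr_fun hf p
    exact fun r => DFunLike.congr_fun this r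
  refine ⟨Derivation.mk' ((TrivSqZeroExt.sndHom R R).restrictScalars k ∘ₗ F.toLinearMap) ?_, ?_⟩
  · intro r s
    simp [hfst, mul_comm]
  · intro i
    change (F (rdpAuxG k P R (X i))).snd = a i
    rw [hF]
    simp [f]


theorem rdpAux_reg (M : Submonoid (MvPolynomial (Fin 3) k ⧸ Ideal.span {P})) [IsLocalization M R]
    (e : MvPolynomial (Fin 3) k) (hP : P = X 2 ^ 2 + X 1 * e) :
    (∀ t : R, rdpAuxG k P R (X 1) * t = 0 → t = 0) ∧
    (∀ t : R, rdpAuxG k P R (X 1) ∣ rdpAuxG k P R (X 0) ^ 2 * t → rdpAuxG k P R (X 1) ∣ t) := by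
  obtain ⟨hA, hB⟩ := rdpAux_mem P e hP
  have hsurj : ∀ t : R, ∃ p l : MvPolynomial (Fin 3) k,
      Ideal.Quotient.mk (Ideal.span {P}) l ∈ M ∧ t * rdpAuxG k P R l = rdpAuxG k P R p := by
    intro r
    obtain ⟨s, m, rfl⟩ := IsLocalization.exists_mk'_eq M r
    obtain ⟨p, rfl⟩ := Ideal.Quotient.mk_surjective s
    obtain ⟨m, hm⟩ := m
    obtain ⟨l, rfl⟩ := Ideal.Quotient.mk_surjective m
    exact ⟨p, l, hm, IsLocalization.mk'_spec R (Ideal.Quotient.mk (Ideal.span {P}) p) ⟨_, hm⟩⟩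
  have hunit : ∀ l : MvPolynomial (Fin 3) k, Ideal.Quotient.mk (Ideal.span {P}) l ∈ M →
      IsUnit (rdpAuxG k P R l) := fun l hl => IsLocalization.map_units R (⟨_, hl⟩ : M)
  have hzero : ∀ p, rdpAuxG k P R p = 0 → ∃ l : MvPolynomial (Fin 3) k,
      Ideal.Quotient.mk (Ideal.span {P}) l ∈ M ∧ P ∣ l * p := by
    intro p hp
    change algebraMap _ R (Ideal.Quotient.mk (Ideal.span {P}) p) = 0 at hp
    rw [IsLocalization.map_eq_zero_iff M] at hp
    obtain ⟨⟨m, hm⟩, h⟩ := hp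
    obtain ⟨l, rfl⟩ := Ideal.Quotient.mk_surjective m
    refine ⟨l, hm, ?_⟩
    rw [← Ideal.mem_span_singleton, ← Ideal.Quotient.eq_zero_iff_mem, map_mul]
    exact h
  have hdvd0 : ∀ p, P ∣ p → rdpAuxG k P R p = 0 := by
    rintro p ⟨c, rfl⟩
    rw [map_mul, rdpAuxG_P, zero_mul]
  constructor
  · intro t ht
    obtain ⟨p, l, hl, h⟩ := hsurj t
    obtain ⟨m, hm, h2⟩ := hzero (X 1 * p) (by rw [map_mul, ← h, ← mul_assoc, ht, zero_mul])
    have h3 := hdvd0 _ (hA (m * p) (by convert h2 using 1; ring))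
    rw [map_mul, ← h] at h3
    have h4 := (hunit m hm).mul_right_eq_zero.1 h3
    exact (hunit l hl).mul_left_eq_zero.1 h4
  · rintro t ⟨s, hs⟩
    obtain ⟨p, l, hl, h⟩ := hsurj t
    obtain ⟨q, r, hr, h'⟩ := hsurj s
    obtain ⟨m, hm, c, hc⟩ := hzero (X 0 ^ 2 * p * r - X 1 * q * l) (by
      simp only [map_sub, map_mul, map_pow, ← h, ← h']
      linear_combination (rdpAuxG k P R l * rdpAuxG k P R r) * hs)
    obtain ⟨c', d', h3⟩ := hB (m * p * r) (m * q * l) c (by linear_combination hc)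
    have h4 := congrArg (rdpAuxG k P R) h3
    simp only [map_add, map_mul, rdpAuxG_P, ← h, zero_mul, add_zero] at h4
    have hu := ((hunit m hm).mul (hunit l hl)).mul (hunit r hr)
    rw [← hu.dvd_mul_right]
    exact ⟨rdpAuxG k P R c', by rw [← h4]; ring⟩

end

theorem rdpAux_main {k : Type*} [Field k] [CharP k 2] {P : MvPolynomial (Fin 3) k}
  (M : Submonoid (MvPolynomial (Fin 3) k ⧸ Ideal.span {P}))
  (R : Type*) [CommRing R] [Nontrivial R] [Algebra k R]
  [Algebra (MvPolynomial (Fin 3) k ⧸ Ideal.span {P}) R]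
  [IsScalarTower k (MvPolynomial (Fin 3) k ⧸ Ideal.span {P}) R] [IsLocalization M R]
  (n : ℕ) (hn : 2 ≤ n)
  (hP2 : P = X 2 ^ 2 + X 0 ^ 2 * X 1 + X 0 * X 1 ^ n ∨
      P = X 2 ^ 2 + X 0 ^ 2 * X 1 + X 1 ^ n * X 2) :
    Module.Free R (Derivation k R R) ∧
      ∃ (D : Derivation k R R) (f : R), IsUnit (D f) := by
  obtain ⟨n, rfl⟩ := Nat.exists_eq_add_of_le' hn
  have hext := rdpAux_ext M (R := R)
  have hex := rdpAux_exists M (R := R)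
  have h0 := rdpAuxG_P (P := P) (R := R)
  have h2 : (2 : R) = 0 := by
    have : ((2 : k)) = 0 := CharTwo.two_eq_zero
    have := congrArg (algebraMap k R) this
    rwa [map_ofNat, map_zero] at this
  have hreg : (∀ t : R, rdpAuxG k P R (X 1) * t = 0 → t = 0) ∧
    (∀ t : R, rdpAuxG k P R (X 1) ∣ rdpAuxG k P R (X 0) ^ 2 * t → rdpAuxG k P R (X 1) ∣ t) := by
    rcases hP2 with h | h
    · exact rdpAux_reg M (X 0 ^ 2 + X 0 * X 1 ^ (n + 1)) (by rw [h]; ring)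
    · exact rdpAux_reg M (X 0 ^ 2 + X 1 ^ (n + 1) * X 2) (by rw [h]; ring)
  obtain ⟨hy, hxy⟩ := hreg
  have h0' : aeval (fun i => rdpAuxG k P R (X i)) P = 0 := by
    rw [← h0, ← MvPolynomial.comp_aeval_apply]; simp
  generalize hG : (fun i => rdpAuxG k P R (X i)) = g at *
  have hg : ∀ i, rdpAuxG k P R (X i) = g i := fun i => by rw [← hG]
  simp only [hg] at *
  clear h0
  rcases hP2 with h | h
  · refine rdpAux_free (g 0) (g 1) (g 2) (g 1)
      (g 0 ^ 2 + (n + 2 : ℕ) * g 0 * g 1 ^ (n + 1)) (n + 2) ?_ ?_ ?_ hy ?_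
    · intro D D' e0 e1 e2
      apply hext
      intro i; fin_cases i <;> assumption
    · intro a b c hr
      obtain ⟨D, hD⟩ := hex ![a, b, c] (by
        rw [h] at h0' ⊢
        simp only [map_add, map_mul, map_pow, aeval_X] at h0' ⊢
        apply TrivSqZeroExt.ext
        · simpa using h0'
        · simp [TrivSqZeroExt.snd_pow, TrivSqZeroExt.snd_mul]
          push_cast at hr
          linear_combination hr + (g 0 * g 1 * a + g 2 * c) * h2)
      exact ⟨D, hD 0, hD 1, hD 2⟩
    · intro D
      have := congrArg D h0'
      rw [h] at this
      simp [Derivation.leibniz_pow] at this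
      push_cast
      linear_combination this - (g 0 * g 1 * D (g 0) + g 2 * D (g 2)) * h2
    · intro t ht
      apply hxy
      have := dvd_sub ht (Dvd.intro ((n + 2 : ℕ) * g 0 * g 1 ^ n * t) rfl)
      convert this using 1
      ring
  · refine rdpAux_free (g 2) (g 1) (g 0) (g 1)
      (g 0 ^ 2 + (n + 2 : ℕ) * g 2 * g 1 ^ (n + 1)) (n + 2) ?_ ?_ ?_ hy ?_
    · intro D D' e0 e1 e2
      apply hext
      intro i; fin_cases i <;> assumption
    · intro a b c hr
      obtain ⟨D, hD⟩ := hex ![c, b, a] (by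
        rw [h] at h0' ⊢
        simp only [map_add, map_mul, map_pow, aeval_X] at h0' ⊢
        apply TrivSqZeroExt.ext
        · simpa using h0'
        · simp [TrivSqZeroExt.snd_pow, TrivSqZeroExt.snd_mul]
          push_cast at hr
          linear_combination hr + (g 0 * g 1 * c + g 2 * a) * h2)
      exact ⟨D, hD 2, hD 1, hD 0⟩
    · intro D
      have := congrArg D h0'
      rw [h] at this
      simp [Derivation.leibniz_pow] at this
      push_cast
      linear_combination this - (g 0 * g 1 * D (g 0) + g 2 * D (g 2)) * h2
    · intro t ht
      apply hxy
      have := dvd_sub ht (Dvd.intro ((n + 2 : ℕ) * g 2 * g 1 ^ n * t) rfl)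
      convert this using 1
      ring

/-- For the rational double points `R` of types `D_{2n}⁰` and `D_{2n+1}⁰` in
characteristic `2`, given by `z² + x²y + x·yⁿ = 0` and `z² + x²y + yⁿ·z = 0` with
`n ≥ 2`: the module `Der_k(R)` of `k`-linear derivations is free, and some derivation
takes a unit value. -/
theorem rdp_D0_char_two_tangent_free (k : Type*) [Field k] [CharP k 2]
    (n : ℕ) (hn : 2 ≤ n) (P : MvPolynomial (Fin 3) k)
    (hP2 : P = X 2 ^ 2 + X 0 ^ 2 * X 1 + X 0 * X 1 ^ n ∨
      P = X 2 ^ 2 + X 0 ^ 2 * X 1 + X 1 ^ n * X 2) :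
    let R := rdpLocal k P (by rcases hP2 with rfl | rfl <;> simp)
    Module.Free R (Derivation k R R) ∧
      ∃ (D : Derivation k R R) (f : R), IsUnit (D f) := by
  intro R
  have hP : constantCoeff P = 0 := by rcases hP2 with h | h <;> rw [h] <;> simp
  exact rdpAux_main (rdpMaxIdeal k P hP).primeCompl
    (Localization (rdpMaxIdeal k P hP).primeCompl) n hn hP2
end
end

section
/- Let k be a field of characteristic 2 and let n, r be integers with n ≥ 2 and 1 ≤ r ≤ n-1. Let R be the localization of the ring k[x,y,z]/(z² + x²·y + y^n·z + x·y^{n-r}·z) at the maximal ideal generated by the images of x, y, z (the rational double point of type D_{2n+1}^r). Then the R-module Der_k(R) of k-linear derivations of R is not free, and there exist no k-linear derivation D of R and element f ∈ R such that D(f) is a unit. -/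
open MvPolynomial

noncomputable section

/-- The equation of the `D_{2n+1}^r` singularity with `n = r + s`. -/
abbrev eqP (k : Type*) [Field k] (r s : ℕ) : MvPolynomial (Fin 3) k :=
  X 2 ^ 2 + X 0 ^ 2 * X 1 + X 1 ^ (r + s) * X 2 + X 0 * X 1 ^ s * X 2

/-- Setting `y = 0`. -/
abbrev thetaY (k : Type*) [Field k] : MvPolynomial (Fin 3) k →ₐ[k] MvPolynomial (Fin 3) k :=
  aeval ![X 0, 0, X 2]

lemma thetaY_dvd {k : Type*} [Field k] (f : MvPolynomial (Fin 3) k) :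
    X 1 ∣ f - thetaY k f := by
  rw [← Ideal.mem_span_singleton, ← Ideal.Quotient.eq]
  have : (Ideal.Quotient.mkₐ k (Ideal.span {(X 1 : MvPolynomial (Fin 3) k)})) =
      (Ideal.Quotient.mkₐ k (Ideal.span {(X 1 : MvPolynomial (Fin 3) k)})).comp (thetaY k) := by
    apply MvPolynomial.algHom_ext
    intro i
    fin_cases i
    · simp
    · simp [Ideal.Quotient.eq_zero_iff_mem, Ideal.mem_span_singleton]
    · simp
  exact DFunLike.congr_fun this f

lemma thetaY_P {k : Type*} [Field k] (r s : ℕ) (hs : 1 ≤ s) :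
    thetaY k (eqP k r s) = X 2 ^ 2 := by
  have h1 : r + s ≠ 0 := by omega
  have h2 : s ≠ 0 := by omega
  simp [thetaY, h1, h2]

lemma X_one_cancel {k : Type*} [Field k] (r s : ℕ) (hs : 1 ≤ s) (g : MvPolynomial (Fin 3) k)
    (h : eqP k r s ∣ X 1 * g) : eqP k r s ∣ g := by
  obtain ⟨c, hc⟩ := h
  have h1 := congrArg (thetaY k) hc
  rw [map_mul, map_mul, thetaY_P r s hs] at h1
  have h0 : thetaY k (X 1) = 0 := by simp [thetaY]
  rw [h0, zero_mul] at h1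
  have h2 : thetaY k c = 0 := by
    rcases mul_eq_zero.1 h1.symm with h | h
    · exact absurd h (pow_ne_zero _ (X_ne_zero _))
    · exact h
  have h3 := thetaY_dvd c
  rw [h2, sub_zero] at h3
  obtain ⟨d, rfl⟩ := h3
  refine ⟨d, mul_left_cancel₀ (X_ne_zero (R := k) (1 : Fin 3)) ?_⟩
  rw [hc]; ring

lemma X_one_dvd {k : Type*} [Field k] (r s : ℕ) (hr : 1 ≤ r) (hs : 1 ≤ s)
    (g b : MvPolynomial (Fin 3) k)
    (h : eqP k r s ∣ X 1 * g - b * (X 0 ^ 2 + ((r + s : ℕ) : MvPolynomial (Fin 3) k) * X 1 ^ (r + s - 1) * X 2 +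
      (s : MvPolynomial (Fin 3) k) * X 0 * X 1 ^ (s - 1) * X 2)) : ∃ h, eqP k r s ∣ b - X 1 * h := by
  obtain ⟨c, hc⟩ := h
  have h1 := congrArg (thetaY k) hc
  have h0 : thetaY k (X 1) = 0 := by simp [thetaY]
  have h0' : thetaY k (X 0) = X 0 := by simp [thetaY]
  have h0'' : thetaY k (X 2) = X 2 := by simp [thetaY]
  rw [map_sub, map_mul, map_mul, map_mul, thetaY_P r s hs, h0] at h1
  simp only [map_add, map_mul, map_pow, map_natCast, h0, h0', h0''] at h1
  have hz : (0 : MvPolynomial (Fin 3) k) ^ (r + s - 1) = 0 := zero_pow (by omega)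
  rw [hz] at h1
  have hprime : Prime (X 2 : MvPolynomial (Fin 3) k) := X_prime
  have hnd : ¬ (X 2 : MvPolynomial (Fin 3) k) ∣ X 0 ^ 2 + ((r + s : ℕ) : MvPolynomial (Fin 3) k) * 0 * X 2 +
      (s : MvPolynomial (Fin 3) k) * X 0 * 0 ^ (s - 1) * X 2 := by
    intro hd
    have : (X 2 : MvPolynomial (Fin 3) k) ∣ X 0 ^ 2 := by
      have h5 : (X 2 : MvPolynomial (Fin 3) k) ∣ (s : MvPolynomial (Fin 3) k) * X 0 * 0 ^ (s - 1) * X 2 :=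
        Dvd.intro_left _ rfl
      simpa using (dvd_add_left h5).1 hd
    have := hprime.dvd_of_dvd_pow this
    rw [X_dvd_X] at this
    simp at this
  have hd : (X 2 : MvPolynomial (Fin 3) k) ^ 2 ∣ thetaY k b := by
    refine hprime.pow_dvd_of_dvd_mul_right 2 hnd ⟨-thetaY k c, ?_⟩
    linear_combination -h1
  obtain ⟨d, hd⟩ := hd
  have h3 := thetaY_dvd b
  obtain ⟨e, he⟩ := h3
  have h4 := thetaY_dvd (eqP k r s)
  rw [thetaY_P r s hs] at h4
  obtain ⟨f, hf⟩ := h4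
  refine ⟨e - f * d, d, ?_⟩
  linear_combination he + hd - d * hf

section core

universe u

variable {k : Type u} [Field k] [CharP k 2] {R : Type u} [CommRing R] [Algebra k R]
  (φ : MvPolynomial (Fin 3) k →ₐ[k] R) (r s : ℕ)

/-- `φ` exhibits `R` as the localization of `k[x,y,z]/(P)` at the origin. -/
structure IsLoc (φ : MvPolynomial (Fin 3) k →ₐ[k] R) (P : MvPolynomial (Fin 3) k) : Prop where
  hP : φ P = 0
  unit : ∀ u, constantCoeff u ≠ 0 → IsUnit (φ u)
  surj : ∀ f, ∃ p u, constantCoeff u ≠ 0 ∧ f * φ u = φ p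
  ker : ∀ p, φ p = 0 → ∃ u, constantCoeff u ≠ 0 ∧ P ∣ u * p
  lift : ∀ (S : Type u) [CommRing S] (g : MvPolynomial (Fin 3) k →+* S), g P = 0 →
    (∀ u, constantCoeff u ≠ 0 → IsUnit (g u)) → ∃ h : R →+* S, ∀ p, h (φ p) = g p

variable {φ r s}

lemma IsLoc.ext {P : MvPolynomial (Fin 3) k} (H : IsLoc φ P) {S : Type*} [CommRing S]
    (g h : R →+* S) (e : ∀ p, g (φ p) = h (φ p)) (f : R) : g f = h f := by
  obtain ⟨p, u, hu, hf⟩ := H.surj f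
  have h1 := congrArg g hf
  have h2 := congrArg h hf
  rw [map_mul] at h1 h2
  have h3 := (H.unit u hu).map h
  apply h3.mul_right_cancel
  rw [h2, ← e, ← e, h1]

lemma IsLoc.der_ext {P : MvPolynomial (Fin 3) k} (H : IsLoc φ P) {N : Type*} [AddCommGroup N]
    [Module R N] [Module k N] (D : Derivation k R N) (h : ∀ i, D (φ (X i)) = 0) (f : R) :
    D f = 0 := by
  have hp : ∀ p, D (φ p) = 0 := by
    intro p
    induction p using MvPolynomial.induction_on with
    | C a =>
      rw [show C a = algebraMap k (MvPolynomial (Fin 3) k) a from rfl, AlgHom.commutes]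
      exact D.map_algebraMap a
    | add p q hp hq => rw [map_add, map_add, hp, hq, add_zero]
    | mul_X p i hp => rw [map_mul, D.leibniz, hp, h, smul_zero, smul_zero, add_zero]
  obtain ⟨p, u, hu, hf⟩ := H.surj f
  have h1 := congrArg D hf
  rw [D.leibniz, hp, hp, smul_zero, zero_add] at h1
  obtain ⟨v, hv⟩ := H.unit u hu
  rw [← hv] at h1
  have h2 := congrArg (fun t => (↑v⁻¹ : R) • t) h1
  simpa [smul_smul] using h2

lemma IsLoc.y_cancel (H : IsLoc φ (eqP k r s)) (hs : 1 ≤ s) (g : R)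
    (h : φ (X 1) * g = 0) : g = 0 := by
  obtain ⟨p, u, hu, hg⟩ := H.surj g
  have : φ (X 1 * p) = 0 := by rw [map_mul, ← hg, ← mul_assoc, h, zero_mul]
  obtain ⟨v, hv, hd⟩ := H.ker _ this
  have h2 : eqP k r s ∣ v * p := X_one_cancel r s hs _ (by convert hd using 1; ring)
  obtain ⟨c, hc⟩ := h2
  have h3 := congrArg φ hc
  rw [map_mul, map_mul _ (eqP k r s), H.hP, zero_mul] at h3
  have h4 := (H.unit v hv).mul_right_eq_zero.1 h3
  rw [h4] at hg
  exact (H.unit u hu).mul_left_eq_zero.1 hg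

/-- The partial derivative of `P` in `y`. -/
abbrev Qp (φ : MvPolynomial (Fin 3) k →ₐ[k] R) (r s : ℕ) : R :=
  φ (X 0) ^ 2 + (r + s : ℕ) * φ (X 1) ^ (r + s - 1) * φ (X 2) +
      (s : ℕ) * φ (X 0) * φ (X 1) ^ (s - 1) * φ (X 2)

lemma IsLoc.y_dvd (H : IsLoc φ (eqP k r s)) (hr : 1 ≤ r) (hs : 1 ≤ s) (b : R)
    (h : φ (X 1) ∣ b * Qp φ r s) : φ (X 1) ∣ b := by
  obtain ⟨g, hg⟩ := h
  obtain ⟨p, u, hu, hp⟩ := H.surj g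
  obtain ⟨q, v, hv, hq⟩ := H.surj b
  have h1 : φ (X 1 * (v * p) - (u * q) * (X 0 ^ 2 + ((r + s : ℕ) : MvPolynomial (Fin 3) k) * X 1 ^ (r + s - 1) * X 2 +
      (s : MvPolynomial (Fin 3) k) * X 0 * X 1 ^ (s - 1) * X 2)) = 0 := by
    simp only [map_sub, map_mul, map_add, map_pow, map_natCast]
    rw [← hp, ← hq]
    linear_combination (-φ u * φ v) * hg
  obtain ⟨t, ht, hd⟩ := H.ker _ h1
  obtain ⟨e, c, hc⟩ := X_one_dvd r s hr hs (t * (v * p)) (t * (u * q))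
    (by convert hd using 1; ring)
  have h3 := congrArg φ hc
  rw [map_mul _ (eqP k r s), H.hP, zero_mul, map_sub, sub_eq_zero] at h3
  simp only [map_mul] at h3
  rw [← hq] at h3
  have hU := ((H.unit t ht).mul (H.unit u hu)).mul (H.unit v hv)
  rw [← hU.dvd_mul_right]
  exact ⟨φ e, by rw [← h3]; ring⟩

lemma IsLoc.y_pow_dvd (H : IsLoc φ (eqP k r s)) (hr : 1 ≤ r) (hs : 1 ≤ s) (m : ℕ) (b : R)
    (h : φ (X 1) ^ m ∣ b * Qp φ r s) : φ (X 1) ^ m ∣ b := by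
  induction m generalizing b with
  | zero => simp
  | succ m ih =>
    obtain ⟨b', rfl⟩ := H.y_dvd hr hs b ((dvd_pow_self _ (by omega)).trans h)
    obtain ⟨c, hc⟩ := h
    have : b' * Qp φ r s = φ (X 1) ^ m * c := by
      rw [← sub_eq_zero]
      apply H.y_cancel hs
      linear_combination hc
    obtain ⟨d, rfl⟩ := ih b' ⟨c, this⟩
    exact ⟨d, by ring⟩

lemma IsLoc.rho (H : IsLoc φ (eqP k r s)) (hs : 1 ≤ s) (α γ : k) :
    ∃ ρ : R →+* DualNumber k, (∀ f, IsUnit f ↔ (ρ f).fst ≠ 0) ∧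
      ρ (φ (X 0)) = TrivSqZeroExt.inr α ∧ ρ (φ (X 1)) = 0 ∧
      ρ (φ (X 2)) = TrivSqZeroExt.inr γ := by
  let g : MvPolynomial (Fin 3) k →ₐ[k] DualNumber k :=
    aeval ![TrivSqZeroExt.inr α, 0, TrivSqZeroExt.inr γ]
  have hfst : ∀ p, (g p).fst = constantCoeff p := by
    intro p
    induction p using MvPolynomial.induction_on with
    | C a => simp [g, TrivSqZeroExt.algebraMap_eq_inl]
    | add p q hp hq => rw [map_add, map_add, TrivSqZeroExt.fst_add, hp, hq]
    | mul_X p i hp =>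
      rw [map_mul, TrivSqZeroExt.fst_mul, map_mul, hp, constantCoeff_X]
      congr 1
      fin_cases i <;> simp [g]
  obtain ⟨ρ, hρ⟩ := H.lift (DualNumber k) (g : MvPolynomial (Fin 3) k →+* DualNumber k)
    (by
      have h1 : r + s ≠ 0 := by omega
      have h2 : s ≠ 0 := by omega
      simp [g, h1, h2, pow_two])
    (by
      intro u hu
      rw [TrivSqZeroExt.isUnit_iff_isUnit_fst, isUnit_iff_ne_zero]
      exact (hfst u).trans_ne hu)
  refine ⟨ρ, ?_, ?_, ?_, ?_⟩
  · intro f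
    constructor
    · intro hf
      have := hf.map ρ
      rwa [TrivSqZeroExt.isUnit_iff_isUnit_fst, isUnit_iff_ne_zero] at this
    · intro hf
      obtain ⟨p, u, hu, hp⟩ := H.surj f
      have h1 := congrArg (fun t => (ρ t).fst) hp
      simp only [map_mul, hρ, TrivSqZeroExt.fst_mul] at h1
      have h2 : constantCoeff p ≠ 0 := by
        rw [← hfst p]
        refine Eq.trans_ne h1.symm (mul_ne_zero hf ?_)
        exact (hfst u).trans_ne hu
      exact isUnit_of_mul_isUnit_left (hp ▸ H.unit p h2)
  all_goals rw [hρ]; simp [g]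

lemma IsLoc.sigma (H : IsLoc φ (eqP k r s)) (hr : 1 ≤ r) (hs : 1 ≤ s) (a b c : R)
    (h : a * φ (X 2) + b * Qp φ r s + c * (φ (X 1) ^ r + φ (X 0)) = 0) : ¬ IsUnit b := by
  let S := PowerSeries k ⧸ Ideal.span {(PowerSeries.X : PowerSeries k) ^ (2 * r + 1)}
  let g : MvPolynomial (Fin 3) k →ₐ[k] PowerSeries k :=
    aeval ![PowerSeries.X ^ r, PowerSeries.X, 0]
  let q : PowerSeries k →+* S := Ideal.Quotient.mk _
  have hcc : ∀ p, PowerSeries.constantCoeff (g p) = constantCoeff p := by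
    intro p
    induction p using MvPolynomial.induction_on with
    | C a => simp [g, PowerSeries.algebraMap_apply]
    | add p q hp hq => rw [map_add, map_add, map_add, hp, hq]
    | mul_X p i hp =>
      rw [map_mul, map_mul, map_mul, hp, constantCoeff_X]
      congr 1
      have : r ≠ 0 := by omega
      fin_cases i <;> simp [g, this]
  obtain ⟨σ, hσ⟩ := H.lift S (q.comp (g : MvPolynomial (Fin 3) k →+* PowerSeries k))
    (by
      have : g (eqP k r s) = PowerSeries.X ^ (2 * r + 1) := by
        simp [g]; ring
      simp only [RingHom.comp_apply, RingHom.coe_coe, this, q]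
      rw [Ideal.Quotient.eq_zero_iff_mem]
      exact Ideal.mem_span_singleton_self _)
    (by
      intro u hu
      rw [RingHom.comp_apply]
      apply IsUnit.map
      rw [PowerSeries.isUnit_iff_constantCoeff, isUnit_iff_ne_zero]
      exact (hcc u).trans_ne hu)
  intro hb
  have h1 := congrArg σ h
  have e0 : σ (φ (X 0)) = q (PowerSeries.X) ^ r := by rw [hσ]; simp [g]
  have e1 : σ (φ (X 1)) = q (PowerSeries.X) := by rw [hσ]; simp [g]
  have e2 : σ (φ (X 2)) = 0 := by rw [hσ]; simp [g]
  have h2 : (2 : S) = 0 := by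
    have : ((2 : k)) = 0 := CharTwo.two_eq_zero
    have := congrArg (algebraMap k S) this
    rwa [map_ofNat, map_zero] at this
  simp only [Qp, map_add, map_mul, map_pow, e0, e1, e2, map_zero, mul_zero, zero_add, add_zero] at h1
  rw [← two_mul, h2, zero_mul, mul_zero, add_zero] at h1
  have h3 := (hb.map σ).mul_right_eq_zero.1 h1
  rw [← pow_mul, ← map_pow, Ideal.Quotient.eq_zero_iff_mem, Ideal.mem_span_singleton,
    PowerSeries.X_pow_dvd_iff] at h3
  have := h3 (r * 2) (by omega)
  simp [PowerSeries.coeff_X_pow] at this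

/-- Syzygies of `(z, P_y, w)` have entries in the maximal ideal. -/
lemma IsLoc.syz (H : IsLoc φ (eqP k r s)) (hr : 1 ≤ r) (hs : 1 ≤ s) (a b c : R)
    (h : a * φ (X 2) + b * Qp φ r s + c * (φ (X 1) ^ r + φ (X 0)) = 0) :
    ¬ IsUnit a ∧ ¬ IsUnit b ∧ ¬ IsUnit c := by
  have h1 : r ≠ 0 := by omega
  have h2 : r + s - 1 ≠ 0 := by omega
  refine ⟨?_, H.sigma hr hs a b c h, ?_⟩
  · obtain ⟨ρ, hu, e0, e1, e2⟩ := H.rho hs 0 1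
    have h3 := congrArg (fun t => (ρ t).snd) h
    simp [e0, e1, e2, h1, h2] at h3
    rw [hu]
    simpa using h3
  · obtain ⟨ρ, hu, e0, e1, e2⟩ := H.rho hs 1 0
    have h3 := congrArg (fun t => (ρ t).snd) h
    simp [e0, e1, e2, h1, h2, pow_two] at h3
    rw [hu]
    simpa using h3

lemma IsLoc.rel (H : IsLoc φ (eqP k r s)) (D : Derivation k R R) :
    D (φ (X 0)) * (φ (X 1) ^ s * φ (X 2)) + D (φ (X 1)) * Qp φ r s +
      D (φ (X 2)) * (φ (X 1) ^ s * (φ (X 1) ^ r + φ (X 0))) = 0 := by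
  have h2 : (2 : R) = 0 := by
    have : ((2 : k)) = 0 := CharTwo.two_eq_zero
    have := congrArg (algebraMap k R) this
    rwa [map_ofNat, map_zero] at this
  have h := congrArg D H.hP
  simp only [map_add, map_mul, map_pow, D.leibniz, D.leibniz_pow, map_zero, smul_eq_mul,
    nsmul_eq_mul] at h
  rw [pow_add] at h
  linear_combination h - (φ (X 2) * D (φ (X 2)) + φ (X 1) * φ (X 0) * D (φ (X 0))) * h2

lemma IsLoc.der_mem (H : IsLoc φ (eqP k r s)) (hr : 1 ≤ r) (hs : 1 ≤ s)
    (D : Derivation k R R) (i : Fin 3) : ¬ IsUnit (D (φ (X i))) := by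
  have h := H.rel D
  obtain ⟨b, hb⟩ := H.y_pow_dvd hr hs s (D (φ (X 1)))
    ⟨-(D (φ (X 0)) * φ (X 2) + D (φ (X 2)) * (φ (X 1) ^ r + φ (X 0))), by linear_combination h⟩
  rw [hb] at h
  have key : ∀ m (g : R), φ (X 1) ^ m * g = 0 → g = 0 := by
    intro m
    induction m with
    | zero => simp
    | succ m ih =>
      intro g hg
      exact ih g (H.y_cancel hs _ (by rw [← hg]; ring))
  have h' := H.syz hr hs (D (φ (X 0))) b (D (φ (X 2)))
    (key s _ (by linear_combination h))
  fin_cases i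
  · exact h'.1
  · change ¬ IsUnit (D (φ (X 1)))
    rw [hb]
    intro hu
    exact h'.2.1 (isUnit_of_mul_isUnit_right hu)
  · exact h'.2.2

lemma IsLoc.exists_der (H : IsLoc φ (eqP k r s)) (a b c : R)
    (h : a * (φ (X 1) ^ s * φ (X 2)) + b * Qp φ r s +
      c * (φ (X 1) ^ s * (φ (X 1) ^ r + φ (X 0))) = 0) :
    ∃ D : Derivation k R R, D (φ (X 0)) = a ∧ D (φ (X 1)) = b ∧ D (φ (X 2)) = c := by
  have h2 : (2 : R) = 0 := by
    have : ((2 : k)) = 0 := CharTwo.two_eq_zero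
    have := congrArg (algebraMap k R) this
    rwa [map_ofNat, map_zero] at this
  let v : Fin 3 → DualNumber R := fun i =>
    TrivSqZeroExt.inl (φ (X i)) + TrivSqZeroExt.inr (![a, b, c] i)
  let g : MvPolynomial (Fin 3) k →ₐ[k] DualNumber R := aeval v
  have hv : ∀ i, (v i).fst = φ (X i) := by intro i; simp [v]
  have hv' : ∀ i, (v i).snd = ![a, b, c] i := by intro i; simp [v]
  have hfst : ∀ p, (g p).fst = φ p := by
    have : (TrivSqZeroExt.fstHom k R R).comp g = φ := by
      apply MvPolynomial.algHom_ext
      intro i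
      simp [g, v]
    exact fun p => DFunLike.congr_fun this p
  obtain ⟨ρ, hρ⟩ := H.lift (DualNumber R) (g : MvPolynomial (Fin 3) k →+* DualNumber R)
    (by
      apply TrivSqZeroExt.ext
      · exact (hfst _).trans H.hP
      · have hP : g (eqP k r s) =
          v 2 ^ 2 + v 0 ^ 2 * v 1 + v 1 ^ (r + s) * v 2 + v 0 * v 1 ^ s * v 2 := by simp [g]
        simp only [RingHom.coe_coe, hP, TrivSqZeroExt.snd_add, TrivSqZeroExt.snd_mul,
          TrivSqZeroExt.snd_pow, TrivSqZeroExt.fst_mul, TrivSqZeroExt.fst_pow, hv, hv',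
          smul_eq_mul, nsmul_eq_mul, op_smul_eq_mul, TrivSqZeroExt.snd_zero]
        simp [-Nat.cast_add]
        rw [pow_add]
        linear_combination h + (φ (X 2) * c + φ (X 1) * φ (X 0) * a) * h2)
    (by
      intro u hu
      rw [TrivSqZeroExt.isUnit_iff_isUnit_fst]
      have := H.unit u hu
      rwa [← hfst] at this)
  have hid : ∀ f, (ρ f).fst = f := by
    intro f
    refine H.ext ((TrivSqZeroExt.fstHom R R R : DualNumber R →+* R).comp ρ) (RingHom.id R) ?_ f
    intro p
    simp [hρ]
    exact hfst p
  have hk : ∀ t : k, ρ (algebraMap k R t) = TrivSqZeroExt.inl (algebraMap k R t) := by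
    intro t
    have : φ (C t) = algebraMap k R t := φ.commutes t
    rw [← this, hρ]
    simp [g, TrivSqZeroExt.algebraMap_eq_inl', this]
  let L : R →ₗ[k] R :=
    { toFun := fun f => (ρ f).snd
      map_add' := by intro f g; simp
      map_smul' := by
        intro t f
        rw [Algebra.smul_def, map_mul, hk]
        simp [Algebra.smul_def] }
  let D : Derivation k R R := Derivation.mk' L (by
    intro f g
    change (ρ (f * g)).snd = f • (ρ g).snd + g • (ρ f).snd
    rw [map_mul, TrivSqZeroExt.snd_mul, hid, hid]
    simp [mul_comm])
  have hD : ∀ i, D (φ (X i)) = ![a, b, c] i := by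
    intro i
    change (ρ (φ (X i))).snd = _
    rw [hρ]
    simp [g, hv']
  exact ⟨D, hD 0, hD 1, hD 2⟩

theorem core [IsLocalRing R] (H : IsLoc φ (eqP k r s)) (hr : 1 ≤ r) (hs : 1 ≤ s) :
    ¬ Module.Free R (Derivation k R R) ∧
      ¬ ∃ (D : Derivation k R R) (f : R), IsUnit (D f) := by
  have h2 : (2 : R) = 0 := by
    have : ((2 : k)) = 0 := CharTwo.two_eq_zero
    have := congrArg (algebraMap k R) this
    rwa [map_ofNat, map_zero] at this
  constructor
  · intro hfree
    obtain ⟨E1, a1, b1, c1⟩ := H.exists_der (φ (X 1) ^ r + φ (X 0)) 0 (φ (X 2))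
      (by linear_combination (φ (X 1) ^ r + φ (X 0)) * (φ (X 1) ^ s * φ (X 2)) * h2)
    obtain ⟨E2, a2, b2, c2⟩ := H.exists_der (Qp φ r s) (φ (X 1) ^ s * φ (X 2)) 0
      (by linear_combination (Qp φ r s) * (φ (X 1) ^ s * φ (X 2)) * h2)
    obtain ⟨E3, a3, b3, c3⟩ := H.exists_der 0 (φ (X 1) ^ s * (φ (X 1) ^ r + φ (X 0))) (Qp φ r s)
      (by linear_combination (Qp φ r s) * (φ (X 1) ^ s * (φ (X 1) ^ r + φ (X 0))) * h2)
    let f : Fin 3 → R := ![Qp φ r s, φ (X 1) ^ r + φ (X 0), φ (X 2)]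
    let E : Fin 3 → Derivation k R R := ![E1, E2, E3]
    have hrel : ∑ i, f i • E i = 0 := by
      apply Derivation.ext
      intro t
      refine H.der_ext (∑ i, f i • E i) ?_ t
      intro i
      simp only [Fin.sum_univ_three, f, E, Derivation.add_apply, Derivation.smul_apply,
        Matrix.cons_val_zero, Matrix.cons_val_one, Matrix.cons_val, smul_eq_mul]
      fin_cases i
      · simp only [Fin.zero_eta, a1, a2, a3]
        linear_combination (Qp φ r s) * (φ (X 1) ^ r + φ (X 0)) * h2
      · simp only [Fin.mk_one, b1, b2, b3]
        linear_combination (φ (X 1) ^ r + φ (X 0)) * φ (X 1) ^ s * φ (X 2) * h2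
      · simp only [Fin.reduceFinMk, c1, c2, c3]
        linear_combination (Qp φ r s) * φ (X 2) * h2
    obtain ⟨l, a, y, hay, hfa⟩ := Module.Flat.isTrivialRelation_of_sum_smul_eq_zero hrel
    have hr0 : r ≠ 0 := by omega
    obtain ⟨ρ, hu, e0, e1, e2⟩ := H.rho hs 1 0
    have hE := congrArg (fun D => ρ (D (φ (X 0)))) (hay 0)
    have hsum : ρ ((∑ j, a 0 j • y j) (φ (X 0))) = 0 := by
      have : (∑ j, a 0 j • y j) (φ (X 0)) = ∑ j, a 0 j * y j (φ (X 0)) := by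
        rw [← Derivation.coeFnAddMonoidHom_apply, map_sum, Finset.sum_apply]
        rfl
      rw [this, map_sum]
      apply Finset.sum_eq_zero
      intro j _
      have hj := hfa j
      rw [Fin.sum_univ_three] at hj
      simp only [f, Matrix.cons_val_zero, Matrix.cons_val_one, Matrix.cons_val] at hj
      have hn := (H.syz hr hs (a 2 j) (a 0 j) (a 1 j) (by linear_combination hj)).2.1
      have hm := H.der_mem hr hs (y j) 0
      rw [hu, not_not] at hn hm
      rw [map_mul]
      apply TrivSqZeroExt.ext <;> simp [hn, hm]
    have hE' : ρ (φ (X 1) ^ r + φ (X 0)) = 0 := by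
      rw [← a1]; exact hE.trans hsum
    rw [map_add, map_pow, e0, e1, zero_pow hr0, zero_add] at hE'
    have := congrArg TrivSqZeroExt.snd hE'
    simp at this
  · rintro ⟨D, f, hf⟩
    let π : R →ₗ[R] IsLocalRing.ResidueField R := Algebra.linearMap R _
    have h0 : (π.compDer D) f = 0 := by
      refine H.der_ext (π.compDer D) ?_ f
      intro i
      change IsLocalRing.residue R (D (φ (X i))) = 0
      rw [IsLocalRing.residue_eq_zero_iff]
      exact H.der_mem hr hs D i
    have h1 : IsLocalRing.residue R (D f) = 0 := h0
    rw [IsLocalRing.residue_eq_zero_iff] at h1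
    exact h1 hf

end core

lemma isLoc_rdp {k : Type*} [Field k] (P : MvPolynomial (Fin 3) k) (hP : constantCoeff P = 0) :
    IsLocalRing (rdpLocal k P hP) ∧
    ∃ φ : MvPolynomial (Fin 3) k →ₐ[k] rdpLocal k P hP, IsLoc φ P := by
  let I := rdpMaxIdeal k P hP
  let q : MvPolynomial (Fin 3) k →ₐ[k] (MvPolynomial (Fin 3) k ⧸ Ideal.span {P}) :=
    Ideal.Quotient.mkₐ k _
  have hq : ∀ u, q u ∈ I.primeCompl ↔ constantCoeff u ≠ 0 := by
    intro u
    rfl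
  let a : (MvPolynomial (Fin 3) k ⧸ Ideal.span {P}) →ₐ[k] Localization I.primeCompl :=
    IsScalarTower.toAlgHom k _ _
  have hqP : q P = 0 := Ideal.Quotient.eq_zero_iff_mem.2 (Ideal.mem_span_singleton_self _)
  refine ⟨inferInstanceAs (IsLocalRing (Localization.AtPrime I)), 
    (a.comp q : MvPolynomial (Fin 3) k →ₐ[k] Localization I.primeCompl), ?_, ?_, ?_, ?_, ?_⟩
  · change a (q P) = 0
    rw [hqP, map_zero]
  · intro u hu
    exact IsLocalization.map_units (Localization I.primeCompl) ⟨q u, (hq u).2 hu⟩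
  · intro f
    obtain ⟨⟨p, u⟩, h⟩ := IsLocalization.surj (M := I.primeCompl) (S := Localization I.primeCompl) f
    obtain ⟨p', rfl⟩ := Ideal.Quotient.mk_surjective p
    obtain ⟨u, hu⟩ := u
    obtain ⟨u', rfl⟩ := Ideal.Quotient.mk_surjective u
    exact ⟨p', u', (hq u').1 hu, h⟩
  · intro p hp
    have hp' : algebraMap _ (Localization I.primeCompl) (q p) = 0 := hp
    obtain ⟨⟨u, hu⟩, h⟩ := (IsLocalization.map_eq_zero_iff I.primeCompl
      (Localization I.primeCompl) (q p)).1 hp'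
    obtain ⟨u', rfl⟩ := Ideal.Quotient.mk_surjective u
    refine ⟨u', (hq u').1 hu, ?_⟩
    have h' : Ideal.Quotient.mk (Ideal.span {P}) (u' * p) = 0 := by
      rw [map_mul]; exact h
    rwa [Ideal.Quotient.eq_zero_iff_mem, Ideal.mem_span_singleton] at h'
  · intro S _ g hg hu
    let g' : (MvPolynomial (Fin 3) k ⧸ Ideal.span {P}) →+* S :=
      Ideal.Quotient.lift _ g (by
        intro b hb
        rw [Ideal.mem_span_singleton] at hb
        obtain ⟨c, rfl⟩ := hb
        rw [map_mul, hg, zero_mul])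
    have hg' : ∀ t : I.primeCompl, IsUnit (g' t) := by
      rintro ⟨u, hu'⟩
      obtain ⟨u', rfl⟩ := Ideal.Quotient.mk_surjective u
      exact hu u' ((hq u').1 hu')
    refine ⟨IsLocalization.lift (M := I.primeCompl) (S := Localization I.primeCompl) hg', ?_⟩
    intro p
    exact IsLocalization.lift_eq (M := I.primeCompl) (S := Localization I.primeCompl) hg' (q p)

/-- For the rational double point `R` of type `D_{2n+1}^r` in characteristic `2`, given
by `z² + x²y + yⁿ·z + x·y^{n-r}·z = 0` with `n ≥ 2` and `1 ≤ r ≤ n - 1`: the module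
`Der_k(R)` of `k`-linear derivations is not free, and no derivation takes a unit
value. -/
theorem rdp_D2n1_r_char_two (k : Type*) [Field k] [CharP k 2]
    (n r : ℕ) (hn : 2 ≤ n) (hr1 : 1 ≤ r) (hr : r ≤ n - 1) :
    let R := rdpLocal k
      (X 2 ^ 2 + X 0 ^ 2 * X 1 + X 1 ^ n * X 2 + X 0 * X 1 ^ (n - r) * X 2) (by simp)
    ¬ Module.Free R (Derivation k R R) ∧
      ¬ ∃ (D : Derivation k R R) (f : R), IsUnit (D f) := by
  intro R
  obtain ⟨hl, φ, H⟩ := isLoc_rdp (k := k)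
    (X 2 ^ 2 + X 0 ^ 2 * X 1 + X 1 ^ n * X 2 + X 0 * X 1 ^ (n - r) * X 2) (by simp)
  have hP : (X 2 ^ 2 + X 0 ^ 2 * X 1 + X 1 ^ n * X 2 + X 0 * X 1 ^ (n - r) * X 2 :
      MvPolynomial (Fin 3) k) = eqP k r (n - r) := by
    rw [eqP, show r + (n - r) = n by omega]
  have H' : IsLoc φ (eqP k r (n - r)) := hP ▸ H
  exact core H' hr1 (by omega)
end
end
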